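/- arXiv:2109.14961 — 7 statements merged into one kernel-verified Lean document; each statement's English description precedes it below -/
import Mathlib

section
/- Let e₀, e₁, e₂ ∈ ℤ × ℤ satisfy e₀ + e₁ + e₂ = 0 and |det(eᵢ, eⱼ)| = 1 for all i ≠ j, where det((u₁,u₂),(v₁,v₂)) := u₁·v₂ − u₂·v₁. Let η ∈ ℤ × ℤ be primitive, i.e. its two coordinates are coprime. Then there exists i ∈ {0,1,2} with eᵢ = η or eᵢ = −η, if and only if |det(eᵢ, η)| ≤ 1 for all i ∈ {0,1,2}. -/
/-- If a unit multiple of a nonzero `v` equals a multiple of `u` by an integer of absolute value at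
most `1`, then `u = ±v`. -/
theorem eq_or_eq_neg_of_mul_eq_mul {u v : ℤ × ℤ} {d c : ℤ} (hd : |d| = 1) (hc : |c| ≤ 1)
    (hv : v.1 ≠ 0 ∨ v.2 ≠ 0) (h₁ : d * v.1 = c * u.1) (h₂ : d * v.2 = c * u.2) :
    u = v ∨ u = -v := by
  obtain ⟨hc₁, hc₂⟩ := abs_le.mp hc
  simp only [Prod.ext_iff, Prod.fst_neg, Prod.snd_neg]
  rcases (abs_eq zero_le_one).mp hd with rfl | rfl <;> interval_cases c <;> omega


/-- Lemma on directions at a 3-valent vertex of a non-singular tropical curve: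
the inward primitive directions `e 0, e 1, e 2` balance (`e 0 + e 1 + e 2 = 0`)
and pairwise determinants are `±1`; then one of them equals `±η` (for `η`
primitive) iff all determinants with `η` are at most `1` in absolute value. -/
theorem vertex_direction_iff_det_le_one
    (e : Fin 3 → ℤ × ℤ) (η : ℤ × ℤ)
    (hsum : e 0 + e 1 + e 2 = 0)
    (hdet : ∀ i j : Fin 3, i ≠ j →
      |(e i).1 * (e j).2 - (e i).2 * (e j).1| = 1)
    (hprim : IsCoprime η.1 η.2) :
    (∃ i : Fin 3, e i = η ∨ e i = -η) ↔
      ∀ i : Fin 3, |(e i).1 * η.2 - (e i).2 * η.1| ≤ 1 := by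
  constructor
  · rintro ⟨i, hi⟩ j
    have key : |(e j).1 * η.2 - (e j).2 * η.1| = |(e j).1 * (e i).2 - (e j).2 * (e i).1| := by
      rcases hi with h | h
      · rw [h]
      · rw [h, ← abs_neg]
        congr 1
        simp only [Prod.fst_neg, Prod.snd_neg]
        ring
    rw [key]
    by_cases hji : j = i
    · subst hji
      simp [mul_comm]
    · exact (hdet j i hji).le
  · intro h
    have h₀ := abs_le.mp (h 0)
    have h₁ := abs_le.mp (h 1)
    have h₂ := abs_le.mp (h 2)
    have hd := hdet 0 1 (by decide)
    have hsum₁ := congrArg Prod.fst hsum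
    have hsum₂ := congrArg Prod.snd hsum
    simp only [Prod.fst_add, Prod.snd_add, Prod.fst_zero, Prod.snd_zero] at hsum₁ hsum₂
    have hη : η.1 ≠ 0 ∨ η.2 ≠ 0 := by
      by_contra! hc
      rw [hc.1, hc.2] at hprim
      exact not_isCoprime_zero_zero hprim
    generalize hx : (e 0).1 * η.2 - (e 0).2 * η.1 = x at h₀
    generalize hy : (e 1).1 * η.2 - (e 1).2 * η.1 = y at h₁
    generalize hD : (e 0).1 * (e 1).2 - (e 0).2 * (e 1).1 = d at hd
    have hz : (e 2).1 * η.2 - (e 2).2 * η.1 = -x - y := by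
      linear_combination η.2 * hsum₁ - η.1 * hsum₂ - hx - hy
    rw [hz] at h₂
    -- Cramer's rule in the basis `e 0, e 1`
    have c₁ : d * η.1 = x * (e 1).1 - y * (e 0).1 := by
      rw [← hx, ← hy, ← hD]; ring
    have c₂ : d * η.2 = x * (e 1).2 - y * (e 0).2 := by
      rw [← hx, ← hy, ← hD]; ring
    have hxy : x = 0 ∨ y = 0 ∨ x + y = 0 := by omega
    rcases hxy with rfl | rfl | hxy
    · refine ⟨0, eq_or_eq_neg_of_mul_eq_mul hd (c := -y) (by rw [abs_neg]; exact abs_le.mpr h₁) hη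
        ?_ ?_⟩
      · linear_combination c₁
      · linear_combination c₂
    · refine ⟨1, eq_or_eq_neg_of_mul_eq_mul hd (abs_le.mpr h₀) hη ?_ ?_⟩
      · linear_combination c₁
      · linear_combination c₂
    · refine ⟨2, eq_or_eq_neg_of_mul_eq_mul hd (abs_le.mpr h₁) hη ?_ ?_⟩
      · linear_combination c₁ + (e 1).1 * hxy - y * hsum₁
      · linear_combination c₂ + (e 1).2 * hxy - y * hsum₂
end

section
/- In the local model S(t) for a bounded edge e of C contained in an edge e′ of C′ (see context), suppose δ₂⁰·δ₃⁰·ε₁⁰·ε₂⁰ < 0 (the real phase structures on e and e′ are distinct). Then there exists t₀ > 0 such that for every t ∈ (0, t₀), the set S(t) has exactly two elements, and both elements lie in ℝ × ℝ (i.e., the intersection consists of two distinct real points of multiplicity 1). -/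
open Filter Topology

/-- Local model for the intersection of realisations of two non-singular real
tropical curves, where a bounded edge `e` of `C` (of lattice length `b`, with
vertices `(0,0)` and `(b,b)`) is contained in the interior of an edge `e'` of
`C'`. -/
noncomputable def Sloc (b : ℝ) (m n p q r s : ℕ)
    (ε₁ ε₂ δ₁ δ₂ δ₃ δ₄ : ℝ → ℝ) (t : ℝ) : Set (ℂ × ℂ) :=
  {zw : ℂ × ℂ | zw.1 ≠ 0 ∧ zw.2 ≠ 0 ∧
    (ε₁ t : ℂ) * zw.1 + (ε₂ t : ℂ) * zw.2 = 0 ∧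
    (δ₁ t : ℂ) * ((t ^ b : ℝ) : ℂ) * zw.1 ^ m * zw.2 ^ n
      + (δ₂ t : ℂ) * zw.1 ^ (p + 1) * zw.2 ^ q
      + (δ₃ t : ℂ) * zw.1 ^ p * zw.2 ^ (q + 1)
      + (δ₄ t : ℂ) * zw.1 ^ r * zw.2 ^ s = 0}

/-- A real quadratic with nonzero leading coefficient and positive discriminant has exactly two
complex roots, and both are real. -/
theorem exists_ne_forall_quadratic_eq_zero_iff {A B D : ℝ} (hA : A ≠ 0)
    (hdisc : 0 < B ^ 2 - 4 * A * D) :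
    ∃ x y : ℝ, x ≠ y ∧
      ∀ z : ℂ, (A : ℂ) * z ^ 2 + B * z + D = 0 ↔ z = x ∨ z = y := by
  set σ := √(B ^ 2 - 4 * A * D) with hσ
  have hσpos : 0 < σ := Real.sqrt_pos.mpr hdisc
  have hσsq : σ * σ = B ^ 2 - 4 * A * D := Real.mul_self_sqrt hdisc.le
  refine ⟨(-B + σ) / (2 * A), (-B - σ) / (2 * A), ?_, fun z => ?_⟩
  · intro h
    rw [div_left_inj' (by positivity)] at h
    linarith
  · have hAC : (A : ℂ) ≠ 0 := by exact_mod_cast hA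
    have hd : discrim (A : ℂ) B D = (σ : ℂ) * σ := by
      rw [discrim]
      exact_mod_cast hσsq.symm
    rw [pow_two, quadratic_eq_zero_iff hAC hd]
    push_cast
    rfl

/-- Substituting `w = c * z` in the second equation of the local model leaves a quadratic
in `z`, up to a power of `z`. -/
theorem mem_Sloc_iff {b : ℝ} {m n p q r s : ℕ}
    (h1 : m + n = p + q + 2) (h2 : m + n = r + s + 2)
    {ε₁ ε₂ δ₁ δ₂ δ₃ δ₄ : ℝ → ℝ} {t : ℝ} (hε₁ : ε₁ t ≠ 0) (hε₂ : ε₂ t ≠ 0) (z w : ℂ) :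
    (z, w) ∈ Sloc b m n p q r s ε₁ ε₂ δ₁ δ₂ δ₃ δ₄ t ↔
      z ≠ 0 ∧ w = ((-ε₁ t / ε₂ t : ℝ) : ℂ) * z ∧
        ((δ₁ t * t ^ b * (-ε₁ t / ε₂ t) ^ n : ℝ) : ℂ) * z ^ 2 +
          (((-ε₁ t / ε₂ t) ^ q * (δ₂ t + δ₃ t * (-ε₁ t / ε₂ t)) : ℝ) : ℂ) * z +
          ((δ₄ t * (-ε₁ t / ε₂ t) ^ s : ℝ) : ℂ) = 0 := by
  set c : ℝ := -ε₁ t / ε₂ t with hc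
  have hc0 : (c : ℂ) ≠ 0 := by
    exact_mod_cast div_ne_zero (neg_ne_zero.mpr hε₁) hε₂
  have hεC : (ε₂ t : ℂ) ≠ 0 := by exact_mod_cast hε₂
  have hcε : (ε₁ t : ℂ) = -(ε₂ t * c) := by
    rw [hc]
    push_cast
    field_simp
  have hline : (ε₁ t : ℂ) * z + ε₂ t * w = 0 ↔ w = c * z := by
    have hfactor : (ε₁ t : ℂ) * z + ε₂ t * w = ε₂ t * (w - c * z) := by
      rw [hcε]
      ring
    rw [hfactor, mul_eq_zero, or_iff_right hεC, sub_eq_zero]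
  have hcurve : (δ₁ t : ℂ) * ((t ^ b : ℝ) : ℂ) * z ^ m * (c * z) ^ n
      + (δ₂ t : ℂ) * z ^ (p + 1) * (c * z) ^ q
      + (δ₃ t : ℂ) * z ^ p * (c * z) ^ (q + 1)
      + (δ₄ t : ℂ) * z ^ r * (c * z) ^ s =
      z ^ (r + s) * (((δ₁ t * t ^ b * c ^ n : ℝ) : ℂ) * z ^ 2 +
        ((c ^ q * (δ₂ t + δ₃ t * c) : ℝ) : ℂ) * z + ((δ₄ t * c ^ s : ℝ) : ℂ)) := by
    have hmn : z ^ m * z ^ n = z ^ (r + s) * z ^ 2 := by rw [← pow_add, ← pow_add, h2]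
    have hpq : z ^ p * z ^ q = z ^ (r + s) := by
      rw [← pow_add, show p + q = r + s by omega]
    push_cast
    simp only [mul_pow, pow_succ _ p, pow_succ _ q]
    linear_combination (δ₁ t : ℂ) * ((t ^ b : ℝ) : ℂ) * c ^ n * hmn +
      c ^ q * (δ₂ t + δ₃ t * c) * z * hpq
  simp only [Sloc, Set.mem_ofPred_eq]
  rw [hline]
  constructor
  · rintro ⟨hz, -, rfl, h⟩
    rw [hcurve, mul_eq_zero, or_iff_right (pow_ne_zero _ hz)] at h
    exact ⟨hz, rfl, h⟩
  · rintro ⟨hz, rfl, h⟩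
    refine ⟨hz, mul_ne_zero hc0 hz, rfl, ?_⟩
    rw [hcurve, h, mul_zero]

/-- If the real phase structures on `e` and `e'` are distinct
(`δ₂⁰·δ₃⁰·ε₁⁰·ε₂⁰ < 0`), then for all small `t > 0` the intersection consists
of exactly two points, both real. -/
theorem edge_in_edge_distinct_phases_two_real_points
    (b : ℝ) (hb : 0 < b) (m n p q r s : ℕ)
    (h1 : m + n = p + q + 2) (h2 : m + n = r + s + 2)
    (ε₁ ε₂ δ₁ δ₂ δ₃ δ₄ : ℝ → ℝ) (ε₁0 ε₂0 δ₁0 δ₂0 δ₃0 δ₄0 : ℝ)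
    (hε₁ : Tendsto ε₁ (𝓝[>] 0) (𝓝 ε₁0)) (hε₁0 : ε₁0 ≠ 0)
    (hε₂ : Tendsto ε₂ (𝓝[>] 0) (𝓝 ε₂0)) (hε₂0 : ε₂0 ≠ 0)
    (hδ₁ : Tendsto δ₁ (𝓝[>] 0) (𝓝 δ₁0)) (hδ₁0 : δ₁0 ≠ 0)
    (hδ₂ : Tendsto δ₂ (𝓝[>] 0) (𝓝 δ₂0)) (hδ₂0 : δ₂0 ≠ 0)
    (hδ₃ : Tendsto δ₃ (𝓝[>] 0) (𝓝 δ₃0)) (hδ₃0 : δ₃0 ≠ 0)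
    (hδ₄ : Tendsto δ₄ (𝓝[>] 0) (𝓝 δ₄0)) (hδ₄0 : δ₄0 ≠ 0)
    (hsign : δ₂0 * δ₃0 * ε₁0 * ε₂0 < 0) :
    ∃ t₀ > (0 : ℝ), ∀ t : ℝ, 0 < t → t < t₀ →
      (Sloc b m n p q r s ε₁ ε₂ δ₁ δ₂ δ₃ δ₄ t).ncard = 2 ∧
      ∀ zw ∈ Sloc b m n p q r s ε₁ ε₂ δ₁ δ₂ δ₃ δ₄ t,
        zw.1.im = 0 ∧ zw.2.im = 0 := by
  have hc : Tendsto (fun t => -ε₁ t / ε₂ t) (𝓝[>] 0) (𝓝 (-ε₁0 / ε₂0)) :=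
    hε₁.neg.div hε₂ hε₂0
  have htb : Tendsto (fun t : ℝ => t ^ b) (𝓝[>] 0) (𝓝 0) := by
    have h := (Real.continuousAt_rpow_const 0 b (Or.inr hb.le)).tendsto
    rw [Real.zero_rpow hb.ne'] at h
    exact h.mono_left nhdsWithin_le_nhds
  have hdisc := (((hc.pow q).mul (hδ₂.add (hδ₃.mul hc))).pow 2).sub
    ((((hδ₁.mul htb).mul (hc.pow n)).const_mul 4).mul (hδ₄.mul (hc.pow s)))
  have hsum : δ₂0 + δ₃0 * (-ε₁0 / ε₂0) ≠ 0 := by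
    intro h
    have h' : δ₂0 * ε₂0 = δ₃0 * ε₁0 := by
      field_simp at h
      linarith
    have hsq : δ₂0 * δ₃0 * ε₁0 * ε₂0 = (δ₃0 * ε₁0) ^ 2 := by
      linear_combination δ₃0 * ε₁0 * h'
    exact (hsq ▸ hsign).not_ge (sq_nonneg _)
  have hlim : 0 < ((-ε₁0 / ε₂0) ^ q * (δ₂0 + δ₃0 * (-ε₁0 / ε₂0))) ^ 2 -
      4 * (δ₁0 * 0 * (-ε₁0 / ε₂0) ^ n) * (δ₄0 * (-ε₁0 / ε₂0) ^ s) := by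
    have hne := mul_ne_zero (pow_ne_zero q (div_ne_zero (neg_ne_zero.mpr hε₁0) hε₂0)) hsum
    have := pow_pos (abs_pos.mpr hne) 2
    rw [sq_abs] at this
    simpa using this
  obtain ⟨t₀, ht₀, hsmall⟩ := mem_nhdsGT_iff_exists_Ioo_subset.mp
    ((hdisc.eventually (lt_mem_nhds hlim)).and <| (hε₁.eventually_ne hε₁0).and <|
      (hε₂.eventually_ne hε₂0).and <| (hδ₁.eventually_ne hδ₁0).and (hδ₄.eventually_ne hδ₄0))
  refine ⟨t₀, ht₀, fun t ht htt => ?_⟩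
  obtain ⟨hd, he₁, he₂, hd₁, hd₄⟩ := hsmall ⟨ht, htt⟩
  have hct : -ε₁ t / ε₂ t ≠ 0 := div_ne_zero (neg_ne_zero.mpr he₁) he₂
  have hA : δ₁ t * t ^ b * (-ε₁ t / ε₂ t) ^ n ≠ 0 :=
    mul_ne_zero (mul_ne_zero hd₁ (Real.rpow_pos_of_pos ht b).ne') (pow_ne_zero n hct)
  have hD : ((δ₄ t * (-ε₁ t / ε₂ t) ^ s : ℝ) : ℂ) ≠ 0 := by
    exact_mod_cast mul_ne_zero hd₄ (pow_ne_zero s hct)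
  obtain ⟨x, y, hxy, hroots⟩ := exists_ne_forall_quadratic_eq_zero_iff hA hd
  have hS : Sloc b m n p q r s ε₁ ε₂ δ₁ δ₂ δ₃ δ₄ t =
      {((x : ℂ), ((-ε₁ t / ε₂ t : ℝ) : ℂ) * x), ((y : ℂ), ((-ε₁ t / ε₂ t : ℝ) : ℂ) * y)} := by
    ext ⟨z, w⟩
    rw [mem_Sloc_iff h1 h2 he₁ he₂]
    simp only [Set.mem_insert_iff, Set.mem_singleton_iff, Prod.mk.injEq]
    constructor
    · rintro ⟨-, rfl, h⟩
      rcases (hroots z).mp h with rfl | rfl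
      · exact Or.inl ⟨rfl, rfl⟩
      · exact Or.inr ⟨rfl, rfl⟩
    · intro h
      have hz : z = x ∨ z = y := h.imp And.left And.left
      have hquad := (hroots z).mpr hz
      refine ⟨?_, ?_, hquad⟩
      · rintro rfl
        exact hD (by simpa using hquad)
      · rcases h with ⟨rfl, rfl⟩ | ⟨rfl, rfl⟩ <;> rfl
  rw [hS]
  refine ⟨Set.ncard_pair fun h => hxy (Complex.ofReal_injective (congrArg Prod.fst h)), ?_⟩
  rintro _ (rfl | rfl) <;>
    exact ⟨Complex.ofReal_im _, by rw [← Complex.ofReal_mul, Complex.ofReal_im]⟩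
end

section
/- In the local model S(t) for a bounded edge e of C contained in an edge e′ of C′ (see context), set B(t) := δ₂(t)·(−ε₁(t)/ε₂(t))^q + δ₃(t)·(−ε₁(t)/ε₂(t))^(q+1) and A⁰ := δ₁⁰·δ₄⁰·(−ε₁⁰/ε₂⁰)^(n+s). Then: (i) if |B(t)|·t^(−b/2) → +∞ as t → 0⁺, or if B(t)·t^(−b/2) converges to a real number β with β² > 4·A⁰, then there exists t₀ > 0 such that for all t ∈ (0, t₀) the set S(t) has exactly two elements, both lying in ℝ × ℝ; (ii) if B(t)·t^(−b/2) converges to a real number β with β² < 4·A⁰, then there exists t₀ > 0 such that for all t ∈ (0, t₀) the set S(t) has exactly two elements, which are coordinatewise complex conjugates of each other and neither of which lies in ℝ × ℝ. -/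
open Filter Topology

/-- The middle coefficient `B(t)` of the reduced quadratic equation in the
local model. -/
noncomputable def Bfun (q : ℕ) (ε₁ ε₂ δ₂ δ₃ : ℝ → ℝ) (t : ℝ) : ℝ :=
  δ₂ t * (-(ε₁ t) / ε₂ t) ^ q + δ₃ t * (-(ε₁ t) / ε₂ t) ^ (q + 1)

/-- A complex quadratic polynomial with real coefficients and positive discriminant has exactly two
complex roots, both real. -/
theorem exists_real_roots_of_discrim_pos {a b c : ℝ} (ha : a ≠ 0) (h : 0 < discrim a b c) :
    ∃ x y : ℝ, x ≠ y ∧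
      {z : ℂ | (a : ℂ) * (z * z) + b * z + c = 0} = {(x : ℂ), (y : ℂ)} := by
  have hσ : 0 < √(discrim a b c) := Real.sqrt_pos.2 h
  refine ⟨(-b + √(discrim a b c)) / (2 * a), (-b - √(discrim a b c)) / (2 * a), ?_, ?_⟩
  · intro hxy
    rw [div_left_inj' (by positivity)] at hxy
    linarith
  · have hd : discrim (a : ℂ) b c = (√(discrim a b c) : ℂ) * (√(discrim a b c) : ℂ) := by
      rw [← Complex.ofReal_mul, Real.mul_self_sqrt h.le]
      simp [discrim]
    ext z
    simp only [Set.mem_ofPred_eq, Set.mem_insert_iff, Set.mem_singleton_iff]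
    rw [quadratic_eq_zero_iff (Complex.ofReal_ne_zero.2 ha) hd]
    push_cast
    rfl

/-- A complex quadratic polynomial with real coefficients and negative discriminant has exactly two
complex roots, which are non-real and conjugate to each other. -/
theorem exists_conj_roots_of_discrim_neg {a b c : ℝ} (ha : a ≠ 0) (h : discrim a b c < 0) :
    ∃ x : ℂ, x.im ≠ 0 ∧
      {z : ℂ | (a : ℂ) * (z * z) + b * z + c = 0} = {x, starRingEnd ℂ x} := by
  have hσ : 0 < √(-discrim a b c) := Real.sqrt_pos.2 (neg_pos.2 h)
  refine ⟨⟨-b / (2 * a), √(-discrim a b c) / (2 * a)⟩, by positivity, ?_⟩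
  have hd : discrim (a : ℂ) b c =
      (√(-discrim a b c) * Complex.I) * (√(-discrim a b c) * Complex.I) := by
    rw [mul_mul_mul_comm, Complex.I_mul_I, ← Complex.ofReal_mul,
      Real.mul_self_sqrt (neg_pos.2 h).le]
    simp [discrim]
  have ha' : (a : ℂ) ≠ 0 := Complex.ofReal_ne_zero.2 ha
  ext z
  simp only [Set.mem_ofPred_eq, Set.mem_insert_iff, Set.mem_singleton_iff]
  rw [quadratic_eq_zero_iff ha' hd]
  have hx : (⟨-b / (2 * a), √(-discrim a b c) / (2 * a)⟩ : ℂ) =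
      (-b + √(-discrim a b c) * Complex.I) / (2 * a) := by
    rw [Complex.mk_eq_add_mul_I]
    push_cast
    field_simp
  rw [hx]
  simp [sub_eq_add_neg, Complex.conj_ofNat]

/-- Eliminating `w` from the local model leaves a quadratic equation in `z`. -/
theorem Sloc_eq_image {b : ℝ} {m n p q r s : ℕ} (h1 : m + n = p + q + 2) (h2 : m + n = r + s + 2)
    {ε₁ ε₂ δ₁ δ₂ δ₃ δ₄ : ℝ → ℝ} {t : ℝ} (hε₁ : ε₁ t ≠ 0) (hε₂ : ε₂ t ≠ 0) (hδ₄ : δ₄ t ≠ 0) :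
    Sloc b m n p q r s ε₁ ε₂ δ₁ δ₂ δ₃ δ₄ t =
      (fun z : ℂ => (z, ((-(ε₁ t) / ε₂ t : ℝ) : ℂ) * z)) ''
        {z : ℂ | ((δ₁ t * t ^ b * (-(ε₁ t) / ε₂ t) ^ n : ℝ) : ℂ) * (z * z)
          + (Bfun q ε₁ ε₂ δ₂ δ₃ t : ℂ) * z + ((δ₄ t * (-(ε₁ t) / ε₂ t) ^ s : ℝ) : ℂ) = 0} := by
  have hc : -(ε₁ t) / ε₂ t ≠ 0 := div_ne_zero (neg_ne_zero.2 hε₁) hε₂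
  have hlin : (ε₁ t : ℂ) + ε₂ t * ((-(ε₁ t) / ε₂ t : ℝ) : ℂ) = 0 := by
    rw [← Complex.ofReal_mul, mul_div_cancel₀ _ hε₂]
    simp
  have hε₂' : (ε₂ t : ℂ) ≠ 0 := Complex.ofReal_ne_zero.2 hε₂
  unfold Bfun
  generalize -(ε₁ t) / ε₂ t = c at hc hlin ⊢
  have hc' : (c : ℂ) ≠ 0 := Complex.ofReal_ne_zero.2 hc
  have key (z : ℂ) :
      (δ₁ t : ℂ) * ((t ^ b : ℝ) : ℂ) * z ^ m * (c * z) ^ n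
        + (δ₂ t : ℂ) * z ^ (p + 1) * (c * z) ^ q + (δ₃ t : ℂ) * z ^ p * (c * z) ^ (q + 1)
        + (δ₄ t : ℂ) * z ^ r * (c * z) ^ s =
      z ^ (r + s) * (((δ₁ t * t ^ b * c ^ n : ℝ) : ℂ) * (z * z)
        + ((δ₂ t * c ^ q + δ₃ t * c ^ (q + 1) : ℝ) : ℂ) * z + ((δ₄ t * c ^ s : ℝ) : ℂ)) := by
    have e1 : z ^ m * z ^ n = z ^ (r + s) * (z * z) := by rw [← pow_add, h2]; ring
    have e2 : z ^ p * z ^ q = z ^ (r + s) := by rw [← pow_add]; congr 1; omega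
    push_cast
    simp only [mul_pow]
    linear_combination (δ₁ t : ℂ) * ((t ^ b : ℝ) : ℂ) * c ^ n * e1
      + ((δ₂ t : ℂ) * c ^ q * z + (δ₃ t : ℂ) * c ^ (q + 1) * z) * e2
  ext ⟨z, w⟩
  simp only [Sloc, Set.mem_ofPred_eq, Set.mem_image, Prod.mk.injEq]
  constructor
  · rintro ⟨hz, -, hzw, heq⟩
    have hw : (c : ℂ) * z = w :=
      mul_left_cancel₀ hε₂' (by linear_combination z * hlin - hzw)
    subst hw
    rw [key] at heq
    exact ⟨z, (mul_eq_zero.1 heq).resolve_left (pow_ne_zero _ hz), rfl, rfl⟩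
  · rintro ⟨z, hz, rfl, rfl⟩
    have hz0 : z ≠ 0 := by
      rintro rfl
      simp [hδ₄, hc] at hz
    exact ⟨hz0, mul_ne_zero hc' hz0, by linear_combination z * hlin, by rw [key, hz, mul_zero]⟩

/-- Rescaling by a power of `t` relates the discriminant of `a t ^ b z ^ 2 + B z + d` to
`(B t ^ (-b / 2)) ^ 2 - 4 a d`. -/
theorem discrim_eq_rpow_mul {t : ℝ} (ht : 0 < t) (b a B d : ℝ) :
    discrim (a * t ^ b) B d = t ^ b * ((B * t ^ (-(b / 2))) ^ 2 - 4 * (a * d)) := by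
  have h : t ^ b * (t ^ (-(b / 2))) ^ 2 = 1 := by
    rw [← Real.rpow_mul_natCast ht.le, ← Real.rpow_add ht]
    norm_num
  rw [discrim]
  linear_combination -B ^ 2 * h

/-- Case (2) of the theorem on an edge `e` contained in an edge `e'`:
comparing `B(t)` with `t^(b/2)` decides whether the two intersection points
are real or complex conjugate. -/
theorem edge_in_edge_discriminant_dichotomy
    (b : ℝ) (hb : 0 < b) (m n p q r s : ℕ)
    (h1 : m + n = p + q + 2) (h2 : m + n = r + s + 2)
    (ε₁ ε₂ δ₁ δ₂ δ₃ δ₄ : ℝ → ℝ) (ε₁0 ε₂0 δ₁0 δ₂0 δ₃0 δ₄0 : ℝ)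
    (hε₁ : Tendsto ε₁ (𝓝[>] 0) (𝓝 ε₁0)) (hε₁0 : ε₁0 ≠ 0)
    (hε₂ : Tendsto ε₂ (𝓝[>] 0) (𝓝 ε₂0)) (hε₂0 : ε₂0 ≠ 0)
    (hδ₁ : Tendsto δ₁ (𝓝[>] 0) (𝓝 δ₁0)) (hδ₁0 : δ₁0 ≠ 0)
    (hδ₂ : Tendsto δ₂ (𝓝[>] 0) (𝓝 δ₂0)) (hδ₂0 : δ₂0 ≠ 0)
    (hδ₃ : Tendsto δ₃ (𝓝[>] 0) (𝓝 δ₃0)) (hδ₃0 : δ₃0 ≠ 0)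
    (hδ₄ : Tendsto δ₄ (𝓝[>] 0) (𝓝 δ₄0)) (hδ₄0 : δ₄0 ≠ 0) :
    ((Tendsto (fun t : ℝ => |Bfun q ε₁ ε₂ δ₂ δ₃ t| * t ^ (-(b / 2)))
        (𝓝[>] 0) atTop ∨
      (∃ β : ℝ, Tendsto (fun t : ℝ => Bfun q ε₁ ε₂ δ₂ δ₃ t * t ^ (-(b / 2)))
          (𝓝[>] 0) (𝓝 β) ∧
        β ^ 2 > 4 * (δ₁0 * δ₄0 * (-ε₁0 / ε₂0) ^ (n + s)))) →
      ∃ t₀ > (0 : ℝ), ∀ t : ℝ, 0 < t → t < t₀ →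
        (Sloc b m n p q r s ε₁ ε₂ δ₁ δ₂ δ₃ δ₄ t).ncard = 2 ∧
        ∀ zw ∈ Sloc b m n p q r s ε₁ ε₂ δ₁ δ₂ δ₃ δ₄ t,
          zw.1.im = 0 ∧ zw.2.im = 0) ∧
    (∀ β : ℝ, Tendsto (fun t : ℝ => Bfun q ε₁ ε₂ δ₂ δ₃ t * t ^ (-(b / 2)))
        (𝓝[>] 0) (𝓝 β) →
      β ^ 2 < 4 * (δ₁0 * δ₄0 * (-ε₁0 / ε₂0) ^ (n + s)) →
      ∃ t₀ > (0 : ℝ), ∀ t : ℝ, 0 < t → t < t₀ →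
        (Sloc b m n p q r s ε₁ ε₂ δ₁ δ₂ δ₃ δ₄ t).ncard = 2 ∧
        ∀ zw ∈ Sloc b m n p q r s ε₁ ε₂ δ₁ δ₂ δ₃ δ₄ t,
          ((starRingEnd ℂ) zw.1, (starRingEnd ℂ) zw.2) ∈
              Sloc b m n p q r s ε₁ ε₂ δ₁ δ₂ δ₃ δ₄ t ∧
            ¬(zw.1.im = 0 ∧ zw.2.im = 0)) := by
  have hc : Tendsto (fun t => -(ε₁ t) / ε₂ t) (𝓝[>] 0) (𝓝 (-ε₁0 / ε₂0)) := hε₁.neg.div hε₂ hε₂0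
  have hA : Tendsto (fun t => 4 * (δ₁ t * δ₄ t * (-(ε₁ t) / ε₂ t) ^ (n + s))) (𝓝[>] 0)
      (𝓝 (4 * (δ₁0 * δ₄0 * (-ε₁0 / ε₂0) ^ (n + s)))) :=
    ((hδ₁.mul hδ₄).mul (hc.pow _)).const_mul 4
  have hpos : ∀ᶠ t : ℝ in 𝓝[>] 0, 0 < t := self_mem_nhdsWithin
  have hdisc {t : ℝ} (ht : 0 < t) :
      discrim (δ₁ t * t ^ b * (-(ε₁ t) / ε₂ t) ^ n) (Bfun q ε₁ ε₂ δ₂ δ₃ t)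
        (δ₄ t * (-(ε₁ t) / ε₂ t) ^ s) =
      t ^ b * ((Bfun q ε₁ ε₂ δ₂ δ₃ t * t ^ (-(b / 2))) ^ 2
        - 4 * (δ₁ t * δ₄ t * (-(ε₁ t) / ε₂ t) ^ (n + s))) := by
    rw [mul_right_comm, discrim_eq_rpow_mul ht]
    ring
  have hinj (c : ℂ) : Function.Injective (fun z : ℂ => (z, c * z)) :=
    fun _ _ h => (Prod.mk.inj h).1
  have hlead {t : ℝ} (ht : 0 < t) (h₁ : ε₁ t ≠ 0) (h₂ : ε₂ t ≠ 0) (h₃ : δ₁ t ≠ 0) :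
      δ₁ t * t ^ b * (-(ε₁ t) / ε₂ t) ^ n ≠ 0 :=
    mul_ne_zero (mul_ne_zero h₃ (Real.rpow_pos_of_pos ht b).ne')
      (pow_ne_zero _ (div_ne_zero (neg_ne_zero.2 h₁) h₂))
  have hwithin {P : ℝ → Prop} (h : ∀ᶠ t in 𝓝[>] (0 : ℝ), P t) :
      ∃ t₀ > (0 : ℝ), ∀ t : ℝ, 0 < t → t < t₀ → P t := by
    obtain ⟨t₀, ht₀, h⟩ := (mem_nhdsGT_iff_exists_Ioo_subset).1 h
    exact ⟨t₀, ht₀, fun t h0 h1 => h ⟨h0, h1⟩⟩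
  constructor
  · intro h
    have hlt : ∀ᶠ t : ℝ in 𝓝[>] 0, 4 * (δ₁ t * δ₄ t * (-(ε₁ t) / ε₂ t) ^ (n + s)) <
        (Bfun q ε₁ ε₂ δ₂ δ₃ t * t ^ (-(b / 2))) ^ 2 := by
      rcases h with h | ⟨β, hβ, hlt⟩
      · have hsq := (tendsto_pow_atTop two_ne_zero).comp h
        filter_upwards [hA.eventually_lt_const (lt_add_one _), hsq.eventually_gt_atTop _]
          with t ht₁ ht₂
        refine (ht₁.trans ht₂).trans_eq ?_
        simp [mul_pow]
      · exact hA.eventually_lt (hβ.pow 2) hlt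
    apply hwithin
    filter_upwards [hlt, hpos, hε₁.eventually_ne hε₁0, hε₂.eventually_ne hε₂0,
      hδ₁.eventually_ne hδ₁0, hδ₄.eventually_ne hδ₄0] with t hlt ht h₁ h₂ h₃ h₄
    obtain ⟨x, y, hxy, hroots⟩ := exists_real_roots_of_discrim_pos (hlead ht h₁ h₂ h₃)
      ((mul_pos (Real.rpow_pos_of_pos ht b) (sub_pos.2 hlt)).trans_eq (hdisc ht).symm)
    rw [Sloc_eq_image h1 h2 h₁ h₂ h₄, hroots, Set.ncard_image_of_injective _ (hinj _),
      Set.ncard_pair (by exact_mod_cast hxy)]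
    refine ⟨rfl, ?_⟩
    rintro _ ⟨z, rfl | rfl, rfl⟩ <;>
      exact ⟨Complex.ofReal_im _, by rw [Complex.im_ofReal_mul, Complex.ofReal_im, mul_zero]⟩
  · intro β hβ hlt
    apply hwithin
    filter_upwards [(hβ.pow 2).eventually_lt hA hlt, hpos, hε₁.eventually_ne hε₁0,
      hε₂.eventually_ne hε₂0, hδ₁.eventually_ne hδ₁0, hδ₄.eventually_ne hδ₄0]
      with t hlt ht h₁ h₂ h₃ h₄
    obtain ⟨x, hx, hroots⟩ := exists_conj_roots_of_discrim_neg (hlead ht h₁ h₂ h₃)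
      ((hdisc ht).trans_lt (mul_neg_of_pos_of_neg (Real.rpow_pos_of_pos ht b) (sub_neg.2 hlt)))
    rw [Sloc_eq_image h1 h2 h₁ h₂ h₄, hroots, Set.ncard_image_of_injective _ (hinj _),
      Set.ncard_pair fun h => hx (Complex.conj_eq_iff_im.1 h.symm)]
    refine ⟨rfl, ?_⟩
    rintro _ ⟨z, rfl | rfl, rfl⟩
    · exact ⟨⟨_, Or.inr rfl, by simp⟩, fun h => hx h.1⟩
    · exact ⟨⟨x, Or.inl rfl, by simp⟩, fun h => hx (by simpa using h.1)⟩
end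

section
/- In the local model S(t) for a bounded edge e of C contained in an edge e′ of C′ (see context), suppose δ₂⁰·δ₃⁰·ε₁⁰·ε₂⁰ < 0. Set A⁰ := δ₁⁰·(−ε₁⁰/ε₂⁰)^n, B⁰ := δ₂⁰·(−ε₁⁰/ε₂⁰)^q + δ₃⁰·(−ε₁⁰/ε₂⁰)^(q+1) (which is nonzero under the hypothesis), and C⁰ := δ₄⁰·(−ε₁⁰/ε₂⁰)^s. Then there exist t₀ > 0 and functions z₁, z₂ : (0, t₀) → ℝ such that for every t ∈ (0, t₀) one has z₁(t) ≠ z₂(t) and S(t) = {(z₁(t), −ε₁(t)·z₁(t)/ε₂(t)), (z₂(t), −ε₁(t)·z₂(t)/ε₂(t))}, and moreover z₁(t) → −C⁰/B⁰ and t^b·z₂(t) → −B⁰/A⁰ as t → 0⁺ (both limits being nonzero real numbers). In other words, the two real intersection points have tropicalisations converging to the two vertices (0,0) and (b,b) of the edge e. -/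
open Filter Topology

/-- Leading coefficient of the reduced quadratic equation. -/
noncomputable def Acoef (n : ℕ) (ε₁0 ε₂0 δ₁0 : ℝ) : ℝ := δ₁0 * (-ε₁0 / ε₂0) ^ n

/-- Limit of the middle coefficient of the reduced quadratic equation. -/
noncomputable def Bcoef (q : ℕ) (ε₁0 ε₂0 δ₂0 δ₃0 : ℝ) : ℝ :=
  δ₂0 * (-ε₁0 / ε₂0) ^ q + δ₃0 * (-ε₁0 / ε₂0) ^ (q + 1)

/-- Constant coefficient of the reduced quadratic equation. -/
noncomputable def Ccoef (s : ℕ) (ε₁0 ε₂0 δ₄0 : ℝ) : ℝ := δ₄0 * (-ε₁0 / ε₂0) ^ s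

/-- A quadratic family `A T z² + B z + C` whose leading coefficient degenerates through `T → 0`
has one root converging to `-C₀ / B₀` and one root escaping as `-B₀ / (A₀ T)`. -/
lemma exists_roots_of_degenerating_quadratic {ι : Type*} {l : Filter ι} {A B C T : ι → ℝ}
    {A₀ B₀ C₀ : ℝ} (hA : Tendsto A l (𝓝 A₀)) (hB : Tendsto B l (𝓝 B₀))
    (hC : Tendsto C l (𝓝 C₀)) (hT : Tendsto T l (𝓝 0)) (hT0 : ∀ᶠ t in l, T t ≠ 0)
    (hA₀ : A₀ ≠ 0) (hB₀ : B₀ ≠ 0) :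
    ∃ z₁ z₂ : ι → ℝ,
      (∀ᶠ t in l, z₁ t ≠ z₂ t ∧ A t * T t * (z₁ t + z₂ t) = -B t ∧
        A t * T t * (z₁ t * z₂ t) = C t) ∧
      Tendsto z₁ l (𝓝 (-C₀ / B₀)) ∧ Tendsto (fun t => T t * z₂ t) l (𝓝 (-B₀ / A₀)) := by
  set D : ι → ℝ := fun t => 1 - 4 * (A t * C t * T t) / B t ^ 2 with hD
  set u : ι → ℝ := fun t => B t * (1 + √(D t)) / 2 with hu
  have hD1 : Tendsto D l (𝓝 1) := by
    have := tendsto_const_nhds (x := (1 : ℝ)).sub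
      ((((hA.mul hC).mul hT).const_mul 4).div (hB.pow 2) (pow_ne_zero 2 hB₀))
    simpa using this
  have huB : Tendsto u l (𝓝 B₀) := by
    have := (hB.mul ((tendsto_const_nhds (x := (1 : ℝ))).add hD1.sqrt)).div_const 2
    have h2 : B₀ * (1 + √1) / 2 = B₀ := by rw [Real.sqrt_one]; ring
    rwa [h2] at this
  refine ⟨fun t => -C t / u t, fun t => -u t / (A t * T t), ?_, hC.neg.div huB hB₀, ?_⟩
  · filter_upwards [hD1.eventually_const_lt one_pos, huB.eventually_ne hB₀, hA.eventually_ne hA₀,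
      hB.eventually_ne hB₀, hT0] with t hDt hut hAt hBt hTt
    have hR : 0 < √(D t) := Real.sqrt_pos.2 hDt
    have hBD : B t ^ 2 * √(D t) ^ 2 = B t ^ 2 - 4 * (A t * C t * T t) := by
      rw [Real.sq_sqrt hDt.le, hD]
      field_simp
    have hquad : u t ^ 2 + A t * C t * T t = B t * u t := by
      simp only [hu]
      linear_combination hBD / 4
    refine ⟨fun h => ?_, ?_, ?_⟩
    · rw [div_eq_div_iff hut (mul_ne_zero hAt hTt)] at h
      have h2 : u t * (B t * √(D t)) = 0 := by
        have h3 : B t * √(D t) = 2 * u t - B t := by simp only [hu]; ring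
        rw [h3]
        linear_combination hquad + h
      exact mul_ne_zero hut (mul_ne_zero hBt hR.ne') h2
    · field_simp
      linear_combination -hquad
    · field_simp
  · refine (huB.neg.div hA hA₀).congr' ?_
    filter_upwards [hT0, hA.eventually_ne hA₀] with t hTt hAt
    simp only [Pi.div_apply]
    field_simp

/-- On the line `ε₁ z + ε₂ w = 0` the second equation of the local model reduces to a quadratic
equation in `z`, so two distinct roots of the latter describe the whole local model. -/
lemma Sloc_eq_pair {b : ℝ} {m n p q r s : ℕ} (h1 : m + n = p + q + 2) (h2 : m + n = r + s + 2)
    {ε₁ ε₂ δ₁ δ₂ δ₃ δ₄ : ℝ → ℝ} {t x y : ℝ} (hε₁ : ε₁ t ≠ 0) (hε₂ : ε₂ t ≠ 0)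
    (hδ₁ : δ₁ t ≠ 0) (hδ₄ : δ₄ t ≠ 0) (ht : 0 < t)
    (hsum : Acoef n (ε₁ t) (ε₂ t) (δ₁ t) * t ^ b * (x + y) =
      -Bcoef q (ε₁ t) (ε₂ t) (δ₂ t) (δ₃ t))
    (hprod : Acoef n (ε₁ t) (ε₂ t) (δ₁ t) * t ^ b * (x * y) = Ccoef s (ε₁ t) (ε₂ t) (δ₄ t)) :
    Sloc b m n p q r s ε₁ ε₂ δ₁ δ₂ δ₃ δ₄ t =
      {((x : ℂ), ((-(ε₁ t) * x / ε₂ t : ℝ) : ℂ)), ((y : ℂ), ((-(ε₁ t) * y / ε₂ t : ℝ) : ℂ))} := by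
  have hc : -ε₁ t / ε₂ t ≠ 0 := div_ne_zero (neg_ne_zero.2 hε₁) hε₂
  have hline (v : ℝ) : -(ε₁ t) * v / ε₂ t = -ε₁ t / ε₂ t * v := by ring
  have hA : Acoef n (ε₁ t) (ε₂ t) (δ₁ t) * t ^ b ≠ 0 :=
    mul_ne_zero (mul_ne_zero hδ₁ (pow_ne_zero n hc)) (Real.rpow_pos_of_pos ht b).ne'
  have hxy : x * y ≠ 0 := by
    refine right_ne_zero_of_mul (a := Acoef n (ε₁ t) (ε₂ t) (δ₁ t) * t ^ b) ?_
    rw [hprod]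
    exact mul_ne_zero hδ₄ (pow_ne_zero s hc)
  have hx : x ≠ 0 := left_ne_zero_of_mul hxy
  have hy : y ≠ 0 := right_ne_zero_of_mul hxy
  have hw (z w : ℂ) : (ε₁ t : ℂ) * z + (ε₂ t : ℂ) * w = 0 ↔ w = ((-ε₁ t / ε₂ t : ℝ) : ℂ) * z := by
    have hε₂' : (ε₂ t : ℂ) ≠ 0 := Complex.ofReal_ne_zero.2 hε₂
    push_cast
    rw [div_mul_eq_mul_div, eq_div_iff hε₂']
    constructor <;> intro h <;> linear_combination h
  simp only [hline]
  simp only [Acoef, Bcoef, Ccoef] at hsum hprod hA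
  generalize -ε₁ t / ε₂ t = c at *
  have hcC : (c : ℂ) ≠ 0 := Complex.ofReal_ne_zero.2 hc
  have hsumC := congrArg ((↑) : ℝ → ℂ) hsum
  have hprodC := congrArg ((↑) : ℝ → ℂ) hprod
  have hAC := Complex.ofReal_ne_zero.2 hA
  push_cast at hsumC hprodC hAC
  have hfactor (z : ℂ) :
      (δ₁ t : ℂ) * ((t ^ b : ℝ) : ℂ) * z ^ m * (c * z) ^ n
        + (δ₂ t : ℂ) * z ^ (p + 1) * (c * z) ^ q + (δ₃ t : ℂ) * z ^ p * (c * z) ^ (q + 1)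
        + (δ₄ t : ℂ) * z ^ r * (c * z) ^ s
      = z ^ (p + q) * ((δ₁ t : ℂ) * c ^ n * ((t ^ b : ℝ) : ℂ)) * ((z - x) * (z - y)) := by
    have e1 : z ^ m * z ^ n = z ^ (p + q) * z ^ 2 := by rw [← pow_add, ← pow_add, h1]
    have e2 : z ^ r * z ^ s = z ^ (p + q) := by rw [← pow_add]; congr 1; lia
    simp only [mul_pow]
    linear_combination (δ₁ t : ℂ) * ((t ^ b : ℝ) : ℂ) * c ^ n * e1 + (δ₄ t : ℂ) * c ^ s * e2
      + z ^ (p + q) * z * hsumC - z ^ (p + q) * hprodC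
  ext ⟨z, w⟩
  simp only [Sloc, Set.mem_ofPred_eq, Set.mem_insert_iff, Set.mem_singleton_iff, Prod.mk.injEq, hw]
  push_cast
  constructor
  · rintro ⟨hz, -, rfl, h⟩
    rw [hfactor] at h
    have h' := (mul_eq_zero.1 h).resolve_left (mul_ne_zero (pow_ne_zero _ hz) hAC)
    rcases mul_eq_zero.1 h' with h' | h'
    · exact Or.inl ⟨sub_eq_zero.1 h', by rw [sub_eq_zero.1 h']⟩
    · exact Or.inr ⟨sub_eq_zero.1 h', by rw [sub_eq_zero.1 h']⟩
  · rintro (⟨rfl, rfl⟩ | ⟨rfl, rfl⟩)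
    · have hxC : (x : ℂ) ≠ 0 := Complex.ofReal_ne_zero.2 hx
      exact ⟨hxC, mul_ne_zero hcC hxC, rfl, by rw [hfactor]; ring⟩
    · have hyC : (y : ℂ) ≠ 0 := Complex.ofReal_ne_zero.2 hy
      exact ⟨hyC, mul_ne_zero hcC hyC, rfl, by rw [hfactor]; ring⟩

/-- Distinct real phases on `e` and `e'` prevent cancellation in the middle coefficient. -/
lemma Bcoef_ne_zero {q : ℕ} {ε₁0 ε₂0 δ₂0 δ₃0 : ℝ} (hsign : δ₂0 * δ₃0 * ε₁0 * ε₂0 < 0) :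
    Bcoef q ε₁0 ε₂0 δ₂0 δ₃0 ≠ 0 := by
  have hε₁0 : ε₁0 ≠ 0 := by rintro rfl; simp at hsign
  have hε₂0 : ε₂0 ≠ 0 := by rintro rfl; simp at hsign
  have hc : -ε₁0 / ε₂0 ≠ 0 := div_ne_zero (neg_ne_zero.2 hε₁0) hε₂0
  have hfac : Bcoef q ε₁0 ε₂0 δ₂0 δ₃0 = (-ε₁0 / ε₂0) ^ q * (δ₂0 + δ₃0 * (-ε₁0 / ε₂0)) := by
    unfold Bcoef
    ring
  rw [hfac]
  refine mul_ne_zero (pow_ne_zero q hc) fun h => ?_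
  have h' : δ₂0 * ε₂0 = δ₃0 * ε₁0 := by
    field_simp at h
    linear_combination h
  have h3 : δ₂0 * δ₃0 * ε₁0 * ε₂0 = (δ₃0 * ε₁0) ^ 2 := by linear_combination δ₃0 * ε₁0 * h'
  exact hsign.not_ge (h3 ▸ sq_nonneg _)

/-- When the real phase structures on `e` and `e'` are distinct, the two real
intersection points tropicalise to the two vertices `(0,0)` and `(b,b)` of the
edge `e`. -/
theorem edge_in_edge_distinct_phases_points_at_vertices
    (b : ℝ) (hb : 0 < b) (m n p q r s : ℕ)
    (h1 : m + n = p + q + 2) (h2 : m + n = r + s + 2)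
    (ε₁ ε₂ δ₁ δ₂ δ₃ δ₄ : ℝ → ℝ) (ε₁0 ε₂0 δ₁0 δ₂0 δ₃0 δ₄0 : ℝ)
    (hε₁ : Tendsto ε₁ (𝓝[>] 0) (𝓝 ε₁0)) (hε₁0 : ε₁0 ≠ 0)
    (hε₂ : Tendsto ε₂ (𝓝[>] 0) (𝓝 ε₂0)) (hε₂0 : ε₂0 ≠ 0)
    (hδ₁ : Tendsto δ₁ (𝓝[>] 0) (𝓝 δ₁0)) (hδ₁0 : δ₁0 ≠ 0)
    (hδ₂ : Tendsto δ₂ (𝓝[>] 0) (𝓝 δ₂0)) (hδ₂0 : δ₂0 ≠ 0)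
    (hδ₃ : Tendsto δ₃ (𝓝[>] 0) (𝓝 δ₃0)) (hδ₃0 : δ₃0 ≠ 0)
    (hδ₄ : Tendsto δ₄ (𝓝[>] 0) (𝓝 δ₄0)) (hδ₄0 : δ₄0 ≠ 0)
    (hsign : δ₂0 * δ₃0 * ε₁0 * ε₂0 < 0) :
    Bcoef q ε₁0 ε₂0 δ₂0 δ₃0 ≠ 0 ∧
    ∃ t₀ > (0 : ℝ), ∃ z₁ z₂ : ℝ → ℝ,
      (∀ t : ℝ, 0 < t → t < t₀ →
        z₁ t ≠ z₂ t ∧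
        Sloc b m n p q r s ε₁ ε₂ δ₁ δ₂ δ₃ δ₄ t =
          {((z₁ t : ℂ), ((-(ε₁ t) * z₁ t / ε₂ t : ℝ) : ℂ)),
           ((z₂ t : ℂ), ((-(ε₁ t) * z₂ t / ε₂ t : ℝ) : ℂ))}) ∧
      Tendsto z₁ (𝓝[>] 0)
        (𝓝 (-(Ccoef s ε₁0 ε₂0 δ₄0) / Bcoef q ε₁0 ε₂0 δ₂0 δ₃0)) ∧
      -(Ccoef s ε₁0 ε₂0 δ₄0) / Bcoef q ε₁0 ε₂0 δ₂0 δ₃0 ≠ 0 ∧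
      Tendsto (fun t : ℝ => t ^ b * z₂ t) (𝓝[>] 0)
        (𝓝 (-(Bcoef q ε₁0 ε₂0 δ₂0 δ₃0) / Acoef n ε₁0 ε₂0 δ₁0)) ∧
      -(Bcoef q ε₁0 ε₂0 δ₂0 δ₃0) / Acoef n ε₁0 ε₂0 δ₁0 ≠ 0 := by
  have hc0 : -ε₁0 / ε₂0 ≠ 0 := div_ne_zero (neg_ne_zero.2 hε₁0) hε₂0
  have hB0 := Bcoef_ne_zero (q := q) hsign
  have hA0 : Acoef n ε₁0 ε₂0 δ₁0 ≠ 0 := mul_ne_zero hδ₁0 (pow_ne_zero n hc0)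
  have hC0 : Ccoef s ε₁0 ε₂0 δ₄0 ≠ 0 := mul_ne_zero hδ₄0 (pow_ne_zero s hc0)
  have hc : Tendsto (fun t => -ε₁ t / ε₂ t) (𝓝[>] 0) (𝓝 (-ε₁0 / ε₂0)) := hε₁.neg.div hε₂ hε₂0
  have hA : Tendsto (fun t => Acoef n (ε₁ t) (ε₂ t) (δ₁ t)) (𝓝[>] 0) (𝓝 (Acoef n ε₁0 ε₂0 δ₁0)) :=
    hδ₁.mul (hc.pow n)
  have hB : Tendsto (fun t => Bcoef q (ε₁ t) (ε₂ t) (δ₂ t) (δ₃ t)) (𝓝[>] 0)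
      (𝓝 (Bcoef q ε₁0 ε₂0 δ₂0 δ₃0)) :=
    (hδ₂.mul (hc.pow q)).add (hδ₃.mul (hc.pow (q + 1)))
  have hC : Tendsto (fun t => Ccoef s (ε₁ t) (ε₂ t) (δ₄ t)) (𝓝[>] 0) (𝓝 (Ccoef s ε₁0 ε₂0 δ₄0)) :=
    hδ₄.mul (hc.pow s)
  have hT : Tendsto (fun t : ℝ => t ^ b) (𝓝[>] 0) (𝓝 0) := by
    have := (Real.continuousAt_rpow_const 0 b (Or.inr hb.le)).tendsto
    rw [Real.zero_rpow hb.ne'] at this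
    exact this.mono_left nhdsWithin_le_nhds
  have hT0 : ∀ᶠ t : ℝ in 𝓝[>] 0, t ^ b ≠ 0 := by
    filter_upwards [self_mem_nhdsWithin] with t ht using (Real.rpow_pos_of_pos ht b).ne'
  obtain ⟨z₁, z₂, hz, hz₁, hz₂⟩ :=
    exists_roots_of_degenerating_quadratic hA hB hC hT hT0 hA0 hB0
  have hev := (((hz.and (hε₁.eventually_ne hε₁0)).and (hε₂.eventually_ne hε₂0)).and
    (hδ₁.eventually_ne hδ₁0)).and (hδ₄.eventually_ne hδ₄0)
  obtain ⟨t₀, ht₀, hsub⟩ := mem_nhdsGT_iff_exists_Ioo_subset.1 hev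
  refine ⟨hB0, t₀, ht₀, z₁, z₂, fun t ht htt₀ => ?_, hz₁, div_ne_zero (neg_ne_zero.2 hC0) hB0,
    hz₂, div_ne_zero (neg_ne_zero.2 hB0) hA0⟩
  obtain ⟨⟨⟨⟨⟨hne, hsum, hprod⟩, hε₁t⟩, hε₂t⟩, hδ₁t⟩, hδ₄t⟩ := hsub ⟨ht, htt₀⟩
  exact ⟨hne, Sloc_eq_pair h1 h2 hε₁t hε₂t hδ₁t hδ₄t ht hsum hprod⟩
end

section
/- In the local model S(t) for a bounded edge e of C contained in an edge e′ of C′ (see context): if there exists a sequence of positive reals tₖ → 0 such that S(tₖ) has exactly one element for every k (a multiplicity-2 real intersection point), then δ₂⁰·ε₂⁰ = δ₃⁰·ε₁⁰ and δ₁⁰·δ₄⁰·(−ε₁⁰·ε₂⁰)^(n+s) > 0; in particular δ₂⁰·δ₃⁰·ε₁⁰·ε₂⁰ > 0. -/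
open Filter Topology

/-- If a complex quadratic polynomial with nonzero leading and constant coefficients has at most
one nonzero root, then its discriminant vanishes. -/
theorem discrim_eq_zero_of_unique_nonzero_root {A B C : ℂ} (hA : A ≠ 0) (hC : C ≠ 0)
    (h : ∀ u v : ℂ, u ≠ 0 → v ≠ 0 → A * u ^ 2 + B * u + C = 0 → A * v ^ 2 + B * v + C = 0 →
      u = v) : B ^ 2 = 4 * A * C := by
  obtain ⟨d, hd⟩ := IsSquare.exists_sq (B ^ 2 - 4 * A * C) (IsAlgClosed.exists_eq_mul_self _)
  have root : ∀ e : ℂ, e ^ 2 = B ^ 2 - 4 * A * C →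
      A * ((-B + e) / (2 * A)) ^ 2 + B * ((-B + e) / (2 * A)) + C = 0 := by
    intro e he
    field_simp
    linear_combination he
  have ne : ∀ u : ℂ, A * u ^ 2 + B * u + C = 0 → u ≠ 0 := by
    rintro u hu rfl
    exact hC (by simpa using hu)
  have r1 := root d hd.symm
  have r2 := root (-d) (by rw [neg_sq]; exact hd.symm)
  have huv := h _ _ (ne _ r1) (ne _ r2) r1 r2
  have hd0 : d = 0 := by
    field_simp at huv
    linear_combination huv / 2
  rw [hd0] at hd
  linear_combination hd

/-- If the local model has exactly one point, then the discriminant of the quadratic polynomial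
obtained by parametrising the line vanishes. -/
theorem Sloc_discrim_eq_zero {b : ℝ} {m n p q r s : ℕ}
    (h1 : m + n = p + q + 2) (h2 : m + n = r + s + 2)
    {ε₁ ε₂ δ₁ δ₂ δ₃ δ₄ : ℝ → ℝ} {t : ℝ} (ht : 0 < t)
    (hε₁ : ε₁ t ≠ 0) (hε₂ : ε₂ t ≠ 0) (hδ₁ : δ₁ t ≠ 0) (hδ₄ : δ₄ t ≠ 0)
    (hone : (Sloc b m n p q r s ε₁ ε₂ δ₁ δ₂ δ₃ δ₄ t).ncard = 1) :
    (ε₂ t ^ p * (-ε₁ t) ^ q * (δ₂ t * ε₂ t - δ₃ t * ε₁ t)) ^ 2 =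
      4 * (δ₁ t * t ^ b * ε₂ t ^ m * (-ε₁ t) ^ n) * (δ₄ t * ε₂ t ^ r * (-ε₁ t) ^ s) := by
  have hT : t ^ b ≠ 0 := (Real.rpow_pos_of_pos ht b).ne'
  obtain ⟨x, hx⟩ := Set.ncard_eq_one.mp hone
  have cε₁ : (ε₁ t : ℂ) ≠ 0 := by exact_mod_cast hε₁
  have cε₂ : (ε₂ t : ℂ) ≠ 0 := by exact_mod_cast hε₂
  have mem : ∀ u : ℂ, u ≠ 0 →
      ((δ₁ t * t ^ b * ε₂ t ^ m * (-ε₁ t) ^ n : ℝ) : ℂ) * u ^ 2 +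
        ((ε₂ t ^ p * (-ε₁ t) ^ q * (δ₂ t * ε₂ t - δ₃ t * ε₁ t) : ℝ) : ℂ) * u +
        ((δ₄ t * ε₂ t ^ r * (-ε₁ t) ^ s : ℝ) : ℂ) = 0 →
      ((ε₂ t : ℂ) * u, -(ε₁ t : ℂ) * u) = x := by
    intro u hu h
    rw [← Set.mem_singleton_iff, ← hx]
    refine ⟨mul_ne_zero cε₂ hu, mul_ne_zero (neg_ne_zero.mpr cε₁) hu, by ring, ?_⟩
    have e1 : u ^ m * u ^ n = u ^ (r + s) * u ^ 2 := by rw [← pow_add, ← pow_add, h2]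
    have e2 : u ^ p * u ^ q = u ^ (r + s) := by rw [← pow_add]; congr 1; omega
    push_cast at h
    simp only [mul_pow, pow_succ ((ε₂ t : ℂ) * u), pow_succ (-(ε₁ t : ℂ) * u)]
    linear_combination u ^ (r + s) * h +
      (δ₁ t : ℂ) * ((t ^ b : ℝ) : ℂ) * (ε₂ t : ℂ) ^ m * (-(ε₁ t : ℂ)) ^ n * e1 +
      (ε₂ t : ℂ) ^ p * (-(ε₁ t : ℂ)) ^ q *
        ((δ₂ t : ℂ) * (ε₂ t : ℂ) - (δ₃ t : ℂ) * (ε₁ t : ℂ)) * u * e2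
  have key := discrim_eq_zero_of_unique_nonzero_root
    (A := ((δ₁ t * t ^ b * ε₂ t ^ m * (-ε₁ t) ^ n : ℝ) : ℂ))
    (B := ((ε₂ t ^ p * (-ε₁ t) ^ q * (δ₂ t * ε₂ t - δ₃ t * ε₁ t) : ℝ) : ℂ))
    (C := ((δ₄ t * ε₂ t ^ r * (-ε₁ t) ^ s : ℝ) : ℂ))
    (Complex.ofReal_ne_zero.mpr (by simp [*])) (Complex.ofReal_ne_zero.mpr (by simp [*]))
    (fun u v hu hv h h' ↦ mul_left_cancel₀ cε₂
      (congrArg Prod.fst ((mem u hu h).trans (mem v hv h').symm)))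
  exact_mod_cast key

/-- Necessary condition for a multiplicity-2 real tangency along the edge `e`:
if the two intersection points collide for a sequence of parameters tending to
`0`, then the real phase structures agree and `e` is non-twisted. -/
theorem edge_in_edge_tangency_necessary_condition
    (b : ℝ) (hb : 0 < b) (m n p q r s : ℕ)
    (h1 : m + n = p + q + 2) (h2 : m + n = r + s + 2)
    (ε₁ ε₂ δ₁ δ₂ δ₃ δ₄ : ℝ → ℝ) (ε₁0 ε₂0 δ₁0 δ₂0 δ₃0 δ₄0 : ℝ)
    (hε₁ : Tendsto ε₁ (𝓝[>] 0) (𝓝 ε₁0)) (hε₁0 : ε₁0 ≠ 0)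
    (hε₂ : Tendsto ε₂ (𝓝[>] 0) (𝓝 ε₂0)) (hε₂0 : ε₂0 ≠ 0)
    (hδ₁ : Tendsto δ₁ (𝓝[>] 0) (𝓝 δ₁0)) (hδ₁0 : δ₁0 ≠ 0)
    (hδ₂ : Tendsto δ₂ (𝓝[>] 0) (𝓝 δ₂0)) (hδ₂0 : δ₂0 ≠ 0)
    (hδ₃ : Tendsto δ₃ (𝓝[>] 0) (𝓝 δ₃0)) (hδ₃0 : δ₃0 ≠ 0)
    (hδ₄ : Tendsto δ₄ (𝓝[>] 0) (𝓝 δ₄0)) (hδ₄0 : δ₄0 ≠ 0)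
    (tk : ℕ → ℝ) (htkpos : ∀ k, 0 < tk k)
    (htk : Tendsto tk atTop (𝓝 0))
    (hone : ∀ k, (Sloc b m n p q r s ε₁ ε₂ δ₁ δ₂ δ₃ δ₄ (tk k)).ncard = 1) :
    δ₂0 * ε₂0 = δ₃0 * ε₁0 ∧
    0 < δ₁0 * δ₄0 * (-(ε₁0 * ε₂0)) ^ (n + s) ∧
    0 < δ₂0 * δ₃0 * ε₁0 * ε₂0 := by
  have htk' : Tendsto tk atTop (𝓝[>] 0) :=
    tendsto_nhdsWithin_iff.mpr ⟨htk, Eventually.of_forall htkpos⟩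
  have lε₁ := hε₁.comp htk'
  have lε₂ := hε₂.comp htk'
  have lδ₁ := hδ₁.comp htk'
  have lδ₂ := hδ₂.comp htk'
  have lδ₃ := hδ₃.comp htk'
  have lδ₄ := hδ₄.comp htk'
  have hdisc : ∀ᶠ k in atTop, ε₂ (tk k) ≠ 0 ∧
      (ε₂ (tk k) ^ p * (-ε₁ (tk k)) ^ q *
          (δ₂ (tk k) * ε₂ (tk k) - δ₃ (tk k) * ε₁ (tk k))) ^ 2 =
        4 * (δ₁ (tk k) * tk k ^ b * ε₂ (tk k) ^ m * (-ε₁ (tk k)) ^ n) *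
          (δ₄ (tk k) * ε₂ (tk k) ^ r * (-ε₁ (tk k)) ^ s) := by
    filter_upwards [lε₁.eventually_ne hε₁0, lε₂.eventually_ne hε₂0, lδ₁.eventually_ne hδ₁0,
      lδ₄.eventually_ne hδ₄0] with k k1 k2 k3 k4
    exact ⟨k2, Sloc_discrim_eq_zero h1 h2 (htkpos k) k1 k2 k3 k4 (hone k)⟩
  have lT : Tendsto (fun k ↦ tk k ^ b) atTop (𝓝 0) := by
    simpa [Real.zero_rpow hb.ne'] using htk.rpow_const (Or.inr hb.le)
  have heq : δ₂0 * ε₂0 = δ₃0 * ε₁0 := by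
    have hL := (((lε₂.pow p).mul (lε₁.neg.pow q)).mul ((lδ₂.mul lε₂).sub (lδ₃.mul lε₁))).pow 2
    have hR := ((((lδ₁.mul lT).mul (lε₂.pow m)).mul (lε₁.neg.pow n)).const_mul 4).mul
      ((lδ₄.mul (lε₂.pow r)).mul (lε₁.neg.pow s))
    have h := tendsto_nhds_unique_of_eventuallyEq hL hR (hdisc.mono fun k hk ↦ hk.2)
    have h0 : (ε₂0 ^ p * (-ε₁0) ^ q * (δ₂0 * ε₂0 - δ₃0 * ε₁0)) ^ 2 = 0 := by
      rw [h]; ring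
    simpa [hε₁0, hε₂0, sub_eq_zero] using h0
  refine ⟨heq, ?_, ?_⟩
  · refine lt_of_le_of_ne ?_ (Ne.symm (by simp [*]))
    refine ge_of_tendsto ((lδ₁.mul lδ₄).mul ((lε₁.mul lε₂).neg.pow (n + s))) ?_
    filter_upwards [hdisc] with k ⟨hk, hd⟩
    have hT := Real.rpow_pos_of_pos (htkpos k) b
    have hexp : (ε₂ (tk k)) ^ m * (ε₂ (tk k)) ^ n = (ε₂ (tk k)) ^ (r + s + 2) := by
      rw [← pow_add, h2]
    have hsign : δ₁ (tk k) * δ₄ (tk k) * (-(ε₁ (tk k) * ε₂ (tk k))) ^ (n + s) *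
          (4 * tk k ^ b * (ε₂ (tk k) ^ (m + r)) ^ 2) =
        (ε₂ (tk k) ^ p * (-ε₁ (tk k)) ^ q *
          (δ₂ (tk k) * ε₂ (tk k) - δ₃ (tk k) * ε₁ (tk k))) ^ 2 * (ε₂ (tk k) ^ (r + s + 1)) ^ 2 := by
      rw [hd, ← neg_mul, mul_pow]
      simp only [pow_add] at hexp ⊢
      linear_combination 4 * δ₁ (tk k) * δ₄ (tk k) * (-ε₁ (tk k)) ^ n * (-ε₁ (tk k)) ^ s *
        tk k ^ b * ε₂ (tk k) ^ m * (ε₂ (tk k) ^ r) ^ 2 * ε₂ (tk k) ^ s * hexp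
    refine nonneg_of_mul_nonneg_left (b := 4 * tk k ^ b * (ε₂ (tk k) ^ (m + r)) ^ 2) ?_
      (by positivity)
    simp only [Function.comp_apply, hsign]
    positivity
  · have : δ₂0 * δ₃0 * ε₁0 * ε₂0 = (δ₃0 * ε₁0) ^ 2 := by linear_combination δ₃0 * ε₁0 * heq
    rw [this]
    positivity
end

section
/- In the local model S(t) for a segment E strictly contained in edges e of C and e′ of C′ (see context), suppose δ₂(t)·ε₂(t) = δ₃(t)·ε₁(t) for all t > 0 and Π < 0 (equal real phase structures with exact cancellation, and E relatively twisted). Then there exists t₀ > 0 such that for every t ∈ (0, t₀), the set S(t) has exactly two elements, which are coordinatewise complex conjugates of each other and neither of which lies in ℝ × ℝ. -/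
open Filter Topology

/-- Local model for the intersection of realisations of two non-singular real
tropical curves, where a segment `E` with vertices `(0,0)` and `(b,b)` is
strictly contained in both a closed edge `e` of `C` and a closed edge `e'`
of `C'`. -/
noncomputable def Sloc2 (b : ℝ) (m n p q : ℕ)
    (ε₀ ε₁ ε₂ δ₁ δ₂ δ₃ : ℝ → ℝ) (t : ℝ) : Set (ℂ × ℂ) :=
  {zw : ℂ × ℂ | zw.1 ≠ 0 ∧ zw.2 ≠ 0 ∧
    (ε₀ t : ℂ) + (ε₁ t : ℂ) * zw.1 + (ε₂ t : ℂ) * zw.2 = 0 ∧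
    (δ₁ t : ℂ) * ((t ^ b : ℝ) : ℂ) * zw.1 ^ m * zw.2 ^ n
      + (δ₂ t : ℂ) * zw.1 ^ (p + 1) * zw.2 ^ q
      + (δ₃ t : ℂ) * zw.1 ^ p * zw.2 ^ (q + 1) = 0}

open ComplexConjugate in
/-- A real quadratic with negative discriminant vanishes exactly at a pair of distinct complex
conjugate numbers. -/
theorem exists_quadratic_iff_conj_of_discrim_neg {A B C : ℝ} (h : B ^ 2 - 4 * A * C < 0) :
    ∃ ζ : ℂ, ζ.im ≠ 0 ∧
      ∀ z : ℂ, (A : ℂ) * z ^ 2 + B * z + C = 0 ↔ z = ζ ∨ z = conj ζ := by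
  have hA : A ≠ 0 := by rintro rfl; nlinarith [sq_nonneg B]
  have hAC : (A : ℂ) ≠ 0 := by exact_mod_cast hA
  have hs : 0 < 4 * A * C - B ^ 2 := by linarith
  set s := √(4 * A * C - B ^ 2)
  have hs0 : 0 < s := Real.sqrt_pos.2 hs
  have hss : s ^ 2 = 4 * A * C - B ^ 2 := Real.sq_sqrt hs.le
  refine ⟨⟨-B / (2 * A), s / (2 * A)⟩, by simp only; positivity, fun z ↦ ?_⟩
  set ζ : ℂ := ⟨-B / (2 * A), s / (2 * A)⟩
  have hsum : (A : ℂ) * (ζ + conj ζ) = -B := by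
    rw [Complex.add_conj]
    norm_cast
    simp only [ζ]
    field_simp
  have hprod : (A : ℂ) * (ζ * conj ζ) = C := by
    rw [Complex.mul_conj, Complex.normSq_mk]
    norm_cast
    field_simp
    linarith
  have hfac : (A : ℂ) * z ^ 2 + B * z + C = A * ((z - ζ) * (z - conj ζ)) := by
    linear_combination z * hsum - hprod
  rw [hfac, mul_eq_zero, mul_eq_zero, sub_eq_zero, sub_eq_zero]
  simp [hAC]

/-- If, on the line `ε₀ + ε₁ z + ε₂ w = 0`, the second equation of the local model reduces to a
real quadratic in `z` with negative discriminant, then the two curves meet in a pair of complex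
conjugate non-real points. -/
theorem Sloc2_conjugate_pair_of_discrim_neg {b : ℝ} {m n p q : ℕ}
    {ε₀ ε₁ ε₂ δ₁ δ₂ δ₃ : ℝ → ℝ} {t A B C : ℝ} (hε₁ : ε₁ t ≠ 0) (hε₂ : ε₂ t ≠ 0)
    (hdisc : B ^ 2 - 4 * A * C < 0)
    (hquad : ∀ z w : ℂ, z ≠ 0 → w ≠ 0 → (ε₀ t : ℂ) + ε₁ t * z + ε₂ t * w = 0 →
      ((δ₁ t : ℂ) * ((t ^ b : ℝ) : ℂ) * z ^ m * w ^ n + δ₂ t * z ^ (p + 1) * w ^ q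
        + δ₃ t * z ^ p * w ^ (q + 1) = 0 ↔ (A : ℂ) * z ^ 2 + B * z + C = 0)) :
    (Sloc2 b m n p q ε₀ ε₁ ε₂ δ₁ δ₂ δ₃ t).ncard = 2 ∧
      ∀ zw ∈ Sloc2 b m n p q ε₀ ε₁ ε₂ δ₁ δ₂ δ₃ t,
        ((starRingEnd ℂ) zw.1, (starRingEnd ℂ) zw.2) ∈
            Sloc2 b m n p q ε₀ ε₁ ε₂ δ₁ δ₂ δ₃ t ∧
          ¬(zw.1.im = 0 ∧ zw.2.im = 0) := by
  obtain ⟨ζ, hζ, hroots⟩ := exists_quadratic_iff_conj_of_discrim_neg hdisc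
  have hε₂C : (ε₂ t : ℂ) ≠ 0 := by exact_mod_cast hε₂
  let f : ℂ → ℂ := fun z ↦ -(ε₀ t + ε₁ t * z) / ε₂ t
  have hline : ∀ z w : ℂ, (ε₀ t : ℂ) + ε₁ t * z + ε₂ t * w = 0 ↔ w = f z := by
    intro z w
    simp only [f]
    rw [eq_div_iff hε₂C]
    constructor <;> intro h <;> linear_combination h
  have hfim : ∀ z : ℂ, (f z).im = -(ε₁ t * z.im) / ε₂ t := by
    intro z
    simp [f, Complex.div_ofReal_im]
  have hfconj : ∀ z : ℂ, f (starRingEnd ℂ z) = starRingEnd ℂ (f z) := by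
    intro z
    simp [f]
  have hne : ∀ z : ℂ, z.im ≠ 0 → z ≠ 0 := by
    rintro z hz rfl
    simp at hz
  have him : ∀ z : ℂ, z = ζ ∨ z = starRingEnd ℂ ζ → z.im ≠ 0 := by
    rintro z (rfl | rfl) <;> simpa using hζ
  have hmem : ∀ z w : ℂ, (z, w) ∈ Sloc2 b m n p q ε₀ ε₁ ε₂ δ₁ δ₂ δ₃ t ↔
      (z = ζ ∨ z = starRingEnd ℂ ζ) ∧ w = f z := by
    intro z w
    constructor
    · rintro ⟨hz, hw, hl, he⟩
      exact ⟨(hroots z).1 ((hquad z w hz hw hl).1 he), (hline z w).1 hl⟩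
    · rintro ⟨hz, rfl⟩
      have hfz : f z ≠ 0 := hne _ <| by
        rw [hfim]
        exact div_ne_zero (neg_ne_zero.2 (mul_ne_zero hε₁ (him z hz))) hε₂
      have hl := (hline z (f z)).2 rfl
      exact ⟨hne z (him z hz), hfz, hl,
        (hquad z _ (hne z (him z hz)) hfz hl).2 ((hroots z).2 hz)⟩
  constructor
  · have hset : Sloc2 b m n p q ε₀ ε₁ ε₂ δ₁ δ₂ δ₃ t =
        {(ζ, f ζ), (starRingEnd ℂ ζ, f (starRingEnd ℂ ζ))} := by
      ext ⟨z, w⟩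
      rw [hmem]
      simp only [Set.mem_insert_iff, Set.mem_singleton_iff, Prod.mk.injEq]
      grind
    rw [hset, Set.ncard_pair]
    intro h
    exact hζ (Complex.conj_eq_iff_im.1 (Prod.ext_iff.1 h).1.symm)
  · rintro ⟨z, w⟩ hzw
    obtain ⟨hz, rfl⟩ := (hmem z w).1 hzw
    refine ⟨(hmem _ _).2 ⟨?_, (hfconj z).symm⟩, fun h ↦ him z hz h.1⟩
    rcases hz with rfl | rfl <;> simp

/-- If the real phase structures agree with exact cancellation
(`δ₂(t)·ε₂(t) = δ₃(t)·ε₁(t)` for all `t > 0`) and the segment `E` is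
relatively twisted (`Π = δ₁⁰·δ₃⁰·ε₀⁰·ε₂⁰·(−ε₁⁰·ε₂⁰)^(n−q) < 0`), then for all
small `t > 0` the intersection consists of exactly two points, which form a
pair of coordinatewise complex conjugate non-real points. -/
theorem segment_relatively_twisted_conjugate_points
    (b : ℝ) (hb : 0 < b) (m n p q : ℕ)
    (h1 : m + n = p + q + 2) (hmp : p ≤ m) (hnq : q ≤ n)
    (ε₀ ε₁ ε₂ δ₁ δ₂ δ₃ : ℝ → ℝ) (ε₀0 ε₁0 ε₂0 δ₁0 δ₂0 δ₃0 : ℝ)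
    (hε₀ : Tendsto ε₀ (𝓝[>] 0) (𝓝 ε₀0)) (hε₀0 : ε₀0 ≠ 0)
    (hε₁ : Tendsto ε₁ (𝓝[>] 0) (𝓝 ε₁0)) (hε₁0 : ε₁0 ≠ 0)
    (hε₂ : Tendsto ε₂ (𝓝[>] 0) (𝓝 ε₂0)) (hε₂0 : ε₂0 ≠ 0)
    (hδ₁ : Tendsto δ₁ (𝓝[>] 0) (𝓝 δ₁0)) (hδ₁0 : δ₁0 ≠ 0)
    (hδ₂ : Tendsto δ₂ (𝓝[>] 0) (𝓝 δ₂0)) (hδ₂0 : δ₂0 ≠ 0)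
    (hδ₃ : Tendsto δ₃ (𝓝[>] 0) (𝓝 δ₃0)) (hδ₃0 : δ₃0 ≠ 0)
    (hcancel : ∀ t : ℝ, 0 < t → δ₂ t * ε₂ t = δ₃ t * ε₁ t)
    (hPi : δ₁0 * δ₃0 * ε₀0 * ε₂0 * (-(ε₁0 * ε₂0)) ^ (n - q) < 0) :
    ∃ t₀ > (0 : ℝ), ∀ t : ℝ, 0 < t → t < t₀ →
      (Sloc2 b m n p q ε₀ ε₁ ε₂ δ₁ δ₂ δ₃ t).ncard = 2 ∧
      ∀ zw ∈ Sloc2 b m n p q ε₀ ε₁ ε₂ δ₁ δ₂ δ₃ t,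
        ((starRingEnd ℂ) zw.1, (starRingEnd ℂ) zw.2) ∈
            Sloc2 b m n p q ε₀ ε₁ ε₂ δ₁ δ₂ δ₃ t ∧
          ¬(zw.1.im = 0 ∧ zw.2.im = 0) := by
  obtain ⟨k, rfl⟩ := Nat.exists_eq_add_of_le hmp
  obtain ⟨l, rfl⟩ := Nat.exists_eq_add_of_le hnq
  rw [Nat.add_sub_cancel_left] at hPi
  have hT : Tendsto (fun t : ℝ ↦ t ^ b) (𝓝[>] 0) (𝓝 0) := by
    have h := (Real.continuousAt_rpow_const 0 b (Or.inr hb.le)).tendsto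
    rw [Real.zero_rpow hb.ne'] at h
    exact h.mono_left nhdsWithin_le_nhds
  suffices h : ∀ᶠ t in 𝓝[>] (0 : ℝ), ∃ A B C : ℝ, ε₁ t ≠ 0 ∧ ε₂ t ≠ 0 ∧
      B ^ 2 - 4 * A * C < 0 ∧
      ∀ z w : ℂ, z ≠ 0 → w ≠ 0 → (ε₀ t : ℂ) + ε₁ t * z + ε₂ t * w = 0 →
      ((δ₁ t : ℂ) * ((t ^ b : ℝ) : ℂ) * z ^ (p + k) * w ^ (q + l) + δ₂ t * z ^ (p + 1) * w ^ q
        + δ₃ t * z ^ p * w ^ (q + 1) = 0 ↔ (A : ℂ) * z ^ 2 + B * z + C = 0) by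
    obtain ⟨t₀, ht₀, ht⟩ := mem_nhdsGT_iff_exists_Ioo_subset.1 h
    refine ⟨t₀, ht₀, fun t htpos htlt ↦ ?_⟩
    obtain ⟨A, B, C, h₁, h₂, hdisc, hquad⟩ := ht ⟨htpos, htlt⟩
    exact Sloc2_conjugate_pair_of_discrim_neg h₁ h₂ hdisc hquad
  have hPi' : ∀ᶠ t in 𝓝[>] (0 : ℝ),
      δ₁ t * δ₃ t * ε₀ t * ε₂ t * (-(ε₁ t * ε₂ t)) ^ l < 0 :=
    ((((hδ₁.mul hδ₃).mul hε₀).mul hε₂).mul ((hε₁.mul hε₂).neg.pow l)).eventually_lt_const hPi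
  have hreduce : ∀ t : ℝ, 0 < t → ε₂ t ≠ 0 → ∀ z w : ℂ, z ≠ 0 → w ≠ 0 →
      (ε₀ t : ℂ) + ε₁ t * z + ε₂ t * w = 0 →
      ((δ₁ t : ℂ) * ((t ^ b : ℝ) : ℂ) * z ^ (p + k) * w ^ (q + l) + δ₂ t * z ^ (p + 1) * w ^ q
        + δ₃ t * z ^ p * w ^ (q + 1) = 0 ↔
        (δ₁ t : ℂ) * ((t ^ b : ℝ) : ℂ) * ε₂ t * (z ^ k * w ^ l) - δ₃ t * ε₀ t = 0) := by
    intro t ht h₂ z w hz hw hl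
    have hc : (δ₂ t : ℂ) * ε₂ t = δ₃ t * ε₁ t := by exact_mod_cast hcancel t ht
    have h₂C : (ε₂ t : ℂ) ≠ 0 := by exact_mod_cast h₂
    have hfac : (ε₂ t : ℂ) * ((δ₁ t : ℂ) * ((t ^ b : ℝ) : ℂ) * z ^ (p + k) * w ^ (q + l)
        + δ₂ t * z ^ (p + 1) * w ^ q + δ₃ t * z ^ p * w ^ (q + 1)) =
        z ^ p * w ^ q *
          ((δ₁ t : ℂ) * ((t ^ b : ℝ) : ℂ) * ε₂ t * (z ^ k * w ^ l) - δ₃ t * ε₀ t) := by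
      linear_combination z ^ (p + 1) * w ^ q * hc + δ₃ t * z ^ p * w ^ q * hl
    rw [← mul_right_inj' h₂C, mul_zero, hfac]
    simp [hz, hw]
  have hkl : k + l = 2 := by omega
  have hl2 : l ≤ 2 := by omega
  interval_cases l
  · obtain rfl : k = 2 := by omega
    filter_upwards [hPi', self_mem_nhdsWithin, hε₁.eventually_ne hε₁0, hε₂.eventually_ne hε₂0]
      with t hP (ht : 0 < t) h₁ h₂
    refine ⟨δ₁ t * t ^ b * ε₂ t, 0, -(δ₃ t * ε₀ t), h₁, h₂, ?_, fun z w hz hw hl ↦ ?_⟩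
    · have := mul_neg_of_pos_of_neg (Real.rpow_pos_of_pos ht b) hP
      linarith
    · rw [hreduce t ht h₂ z w hz hw hl]
      push_cast
      ring_nf
  · obtain rfl : k = 1 := by omega
    have hsmall : ∀ᶠ t in 𝓝[>] (0 : ℝ), δ₁ t ^ 2 * ε₀ t ^ 2 * ε₂ t ^ 2 * t ^ b
        + 4 * (δ₁ t * δ₃ t * ε₀ t * ε₂ t * (-(ε₁ t * ε₂ t)) ^ 1) < 0 := by
      refine ((((((hδ₁.pow 2).mul (hε₀.pow 2)).mul (hε₂.pow 2)).mul hT).add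
        (((((hδ₁.mul hδ₃).mul hε₀).mul hε₂).mul
          ((hε₁.mul hε₂).neg.pow 1)).const_mul 4))).eventually_lt_const ?_
      linarith
    filter_upwards [hsmall, self_mem_nhdsWithin, hε₁.eventually_ne hε₁0,
      hε₂.eventually_ne hε₂0] with t hP (ht : 0 < t) h₁ h₂
    refine ⟨δ₁ t * t ^ b * ε₁ t * ε₂ t, δ₁ t * t ^ b * ε₀ t * ε₂ t, δ₃ t * ε₀ t * ε₂ t,
      h₁, h₂, ?_, fun z w hz hw hl ↦ ?_⟩
    · have := mul_neg_of_pos_of_neg (Real.rpow_pos_of_pos ht b) hP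
      linarith
    · have h₂C : (ε₂ t : ℂ) ≠ 0 := by exact_mod_cast h₂
      rw [hreduce t ht h₂ z w hz hw hl, ← mul_right_inj' (neg_ne_zero.2 h₂C), mul_zero]
      push_cast
      refine Eq.congr_left ?_
      linear_combination -(δ₁ t : ℂ) * ((t ^ b : ℝ) : ℂ) * ε₂ t * z * hl
  · obtain rfl : k = 0 := by omega
    filter_upwards [hPi', self_mem_nhdsWithin, hε₁.eventually_ne hε₁0, hε₂.eventually_ne hε₂0]
      with t hP (ht : 0 < t) h₁ h₂
    refine ⟨δ₁ t * t ^ b * ε₁ t ^ 2, 2 * δ₁ t * t ^ b * ε₀ t * ε₁ t,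
      δ₁ t * t ^ b * ε₀ t ^ 2 - δ₃ t * ε₀ t * ε₂ t, h₁, h₂, ?_, fun z w hz hw hl ↦ ?_⟩
    · have hP' : δ₁ t * δ₃ t * ε₀ t * ε₂ t < 0 := by
        by_contra! h
        exact absurd hP (not_lt.2 (mul_nonneg h (even_two.pow_nonneg _)))
      have := mul_neg_of_pos_of_neg
        (mul_pos (Real.rpow_pos_of_pos ht b) (pow_pos (abs_pos.2 h₁) 2)) hP'
      rw [sq_abs] at this
      linarith
    · have h₂C : (ε₂ t : ℂ) ≠ 0 := by exact_mod_cast h₂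
      rw [hreduce t ht h₂ z w hz hw hl, ← mul_right_inj' h₂C, mul_zero]
      push_cast
      refine Eq.congr_left ?_
      linear_combination (δ₁ t : ℂ) * ((t ^ b : ℝ) : ℂ) * (ε₂ t * w - ε₀ t - ε₁ t * z) * hl
end

section
/- In the local model S(t) for a segment E strictly contained in edges e of C and e′ of C′ (see context): if there exists a sequence of positive reals tₖ → 0 such that S(tₖ) has exactly one element for every k (a multiplicity-2 real intersection point), then δ₂⁰·ε₂⁰ = δ₃⁰·ε₁⁰ and Π < 0; in particular δ₂⁰·δ₃⁰·ε₁⁰·ε₂⁰ > 0. -/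
open Filter Topology

/-- If the graph of `f` over the roots of a real quadratic polynomial lies in a one-element set,
then the discriminant of the polynomial vanishes. -/
theorem sq_eq_four_mul_of_ncard_eq_one {S : Set (ℂ × ℂ)} (hS : S.ncard = 1) (f : ℂ → ℂ)
    {A B C : ℝ} (hA : A ≠ 0)
    (hf : ∀ z : ℂ, (A : ℂ) * z ^ 2 + B * z + C = 0 → (z, f z) ∈ S) :
    B ^ 2 = 4 * A * C := by
  obtain ⟨x, rfl⟩ := Set.ncard_eq_one.mp hS
  have hA' : (A : ℂ) ≠ 0 := by exact_mod_cast hA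
  obtain ⟨z, hz⟩ : ∃ z : ℂ, (A : ℂ) * z ^ 2 + B * z + C = 0 := by
    obtain ⟨r, hr⟩ := IsAlgClosed.exists_pow_nat_eq (discrim (A : ℂ) B C) two_pos
    obtain ⟨z, hz⟩ := exists_quadratic_eq_zero hA' ⟨r, by rw [← hr, sq]⟩
    exact ⟨z, by rw [← hz]; ring⟩
  have hz' : (A : ℂ) * (-(B / A) - z) ^ 2 + B * (-(B / A) - z) + C = 0 := by
    rw [← hz]
    field_simp
    ring
  have hfst : z = -(B / A) - z :=
    congrArg Prod.fst ((Set.mem_singleton_iff.mp (hf z hz)).trans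
      (Set.mem_singleton_iff.mp (hf _ hz')).symm)
  have hlin : 2 * (A : ℂ) * z + B = 0 := by
    field_simp at hfst
    linear_combination hfst
  have hdisc : (B : ℂ) ^ 2 = 4 * A * C := by
    linear_combination (2 * (A : ℂ) * z + B) * hlin - 4 * (A : ℂ) * hz
  exact_mod_cast hdisc

/-- If `B ^ 2 = s * Y` along a filter, where `s > 0` tends to `0` and `Y` has a nonzero limit,
then `B` tends to `0` and the limit of `Y` is positive. -/
theorem limit_eq_zero_and_pos_of_sq_eq_mul {ι : Type*} {l : Filter ι} [l.NeBot]
    {s B Y : ι → ℝ} {B0 Y0 : ℝ} (hs : Tendsto s l (𝓝 0)) (hspos : ∀ k, 0 < s k)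
    (hB : Tendsto B l (𝓝 B0)) (hY : Tendsto Y l (𝓝 Y0)) (hY0 : Y0 ≠ 0)
    (h : ∀ᶠ k in l, B k ^ 2 = s k * Y k) : B0 = 0 ∧ 0 < Y0 := by
  constructor
  · have hlim := tendsto_nhds_unique_of_eventuallyEq (hB.pow 2) (hs.mul hY) h
    simpa using hlim
  · refine lt_of_le_of_ne (ge_of_tendsto hY (h.mono fun k hk => ?_)) hY0.symm
    exact nonneg_of_mul_nonneg_right (hk ▸ sq_nonneg (B k)) (hspos k)

theorem mem_Sloc2_of_reduced {b : ℝ} {i j p q : ℕ} {ε₀ ε₁ ε₂ δ₁ δ₂ δ₃ : ℝ → ℝ} {t : ℝ} {z w : ℂ}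
    (hz : z ≠ 0) (hw : w ≠ 0) (hlin : (ε₀ t : ℂ) + ε₁ t * z + ε₂ t * w = 0)
    (hred : (δ₁ t : ℂ) * ((t ^ b : ℝ) : ℂ) * z ^ i * w ^ j + δ₂ t * z + δ₃ t * w = 0) :
    (z, w) ∈ Sloc2 b (p + i) (q + j) p q ε₀ ε₁ ε₂ δ₁ δ₂ δ₃ t := by
  refine ⟨hz, hw, hlin, ?_⟩
  linear_combination z ^ p * w ^ q * hred

section Discriminant

variable {b t : ℝ} {p q : ℕ} {ε₀ ε₁ ε₂ δ₁ δ₂ δ₃ : ℝ → ℝ}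

theorem sq_eq_of_ncard_Sloc2_two_zero (ht : t ^ b ≠ 0) (hε₀ : ε₀ t ≠ 0)
    (hε₂ : ε₂ t ≠ 0) (hδ₁ : δ₁ t ≠ 0) (hδ₃ : δ₃ t ≠ 0)
    (hne : δ₂ t * ε₁ t - δ₁ t * t ^ b * ε₀ t ≠ 0)
    (h : (Sloc2 b (p + 2) (q + 0) p q ε₀ ε₁ ε₂ δ₁ δ₂ δ₃ t).ncard = 1) :
    (δ₂ t * ε₂ t - δ₃ t * ε₁ t) ^ 2 = t ^ b * (-4 * (δ₁ t * δ₃ t * ε₀ t * ε₂ t)) := by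
  have hε₀' : (ε₀ t : ℂ) ≠ 0 := by exact_mod_cast hε₀
  have hε₂' : (ε₂ t : ℂ) ≠ 0 := by exact_mod_cast hε₂
  have hδ₃' : (δ₃ t : ℂ) ≠ 0 := by exact_mod_cast hδ₃
  have hne' : (δ₂ t : ℂ) * ε₁ t - δ₁ t * (t ^ b : ℝ) * ε₀ t ≠ 0 := by exact_mod_cast hne
  have key := sq_eq_four_mul_of_ncard_eq_one h (fun z => -(ε₀ t + ε₁ t * z) / ε₂ t)
    (A := t ^ b * δ₁ t * ε₂ t) (B := δ₂ t * ε₂ t - δ₃ t * ε₁ t) (C := -(δ₃ t * ε₀ t))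
    (by positivity) fun z hz => by
      simp only [Complex.ofReal_mul, Complex.ofReal_sub, Complex.ofReal_neg] at hz
      obtain ⟨w, hw⟩ : ∃ w : ℂ, w = -(ε₀ t + ε₁ t * z) / ε₂ t := ⟨_, rfl⟩
      have hlin : (ε₀ t : ℂ) + ε₁ t * z + ε₂ t * w = 0 := by rw [hw]; field_simp; ring
      have hred : (δ₁ t : ℂ) * ((t ^ b : ℝ) : ℂ) * z ^ 2 * w ^ 0 + δ₂ t * z + δ₃ t * w = 0 := by
        apply mul_left_cancel₀ hε₂'
        linear_combination hz + (δ₃ t : ℂ) * hlin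
      have hz0 : z ≠ 0 := by
        rintro rfl
        exact mul_ne_zero hδ₃' hε₀' (by linear_combination -hz)
      rw [← hw]
      refine mem_Sloc2_of_reduced hz0 ?_ hlin hred
      rintro rfl
      apply mul_ne_zero hz0 hne'
      linear_combination (ε₁ t : ℂ) * hred - (δ₁ t : ℂ) * ((t ^ b : ℝ) : ℂ) * z * hlin
  linear_combination key

theorem sq_eq_of_ncard_Sloc2_one_one (ht : t ^ b ≠ 0) (hε₀ : ε₀ t ≠ 0) (hε₁ : ε₁ t ≠ 0)
    (hε₂ : ε₂ t ≠ 0) (hδ₁ : δ₁ t ≠ 0) (hδ₂ : δ₂ t ≠ 0) (hδ₃ : δ₃ t ≠ 0)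
    (h : (Sloc2 b (p + 1) (q + 1) p q ε₀ ε₁ ε₂ δ₁ δ₂ δ₃ t).ncard = 1) :
    (δ₂ t * ε₂ t - δ₃ t * ε₁ t - t ^ b * (δ₁ t * ε₀ t)) ^ 2 =
      t ^ b * (4 * (δ₁ t * δ₃ t * ε₀ t * ε₁ t)) := by
  have hε₀' : (ε₀ t : ℂ) ≠ 0 := by exact_mod_cast hε₀
  have hε₂' : (ε₂ t : ℂ) ≠ 0 := by exact_mod_cast hε₂
  have hδ₂' : (δ₂ t : ℂ) ≠ 0 := by exact_mod_cast hδ₂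
  have hδ₃' : (δ₃ t : ℂ) ≠ 0 := by exact_mod_cast hδ₃
  have key := sq_eq_four_mul_of_ncard_eq_one h (fun z => -(ε₀ t + ε₁ t * z) / ε₂ t)
    (A := -(t ^ b * δ₁ t * ε₁ t)) (B := δ₂ t * ε₂ t - δ₃ t * ε₁ t - t ^ b * (δ₁ t * ε₀ t))
    (C := -(δ₃ t * ε₀ t))
    (neg_ne_zero.mpr (by positivity)) fun z hz => by
      simp only [Complex.ofReal_mul, Complex.ofReal_sub, Complex.ofReal_neg] at hz
      obtain ⟨w, hw⟩ : ∃ w : ℂ, w = -(ε₀ t + ε₁ t * z) / ε₂ t := ⟨_, rfl⟩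
      have hlin : (ε₀ t : ℂ) + ε₁ t * z + ε₂ t * w = 0 := by rw [hw]; field_simp; ring
      have hred : (δ₁ t : ℂ) * ((t ^ b : ℝ) : ℂ) * z ^ 1 * w ^ 1 + δ₂ t * z + δ₃ t * w = 0 := by
        apply mul_left_cancel₀ hε₂'
        linear_combination hz + ((δ₃ t : ℂ) + δ₁ t * ((t ^ b : ℝ) : ℂ) * z) * hlin
      have hz0 : z ≠ 0 := by
        rintro rfl
        exact mul_ne_zero hδ₃' hε₀' (by linear_combination -hz)
      rw [← hw]
      refine mem_Sloc2_of_reduced hz0 ?_ hlin hred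
      rintro rfl
      exact mul_ne_zero hδ₂' hz0 (by linear_combination hred)
  linear_combination key

theorem sq_eq_of_ncard_Sloc2_zero_two (ht : t ^ b ≠ 0) (hε₀ : ε₀ t ≠ 0) (hε₁ : ε₁ t ≠ 0)
    (hε₂ : ε₂ t ≠ 0) (hδ₁ : δ₁ t ≠ 0) (hδ₂ : δ₂ t ≠ 0)
    (hne : t ^ b * (δ₁ t * ε₀ t) - δ₃ t * ε₂ t ≠ 0)
    (h : (Sloc2 b (p + 0) (q + 2) p q ε₀ ε₁ ε₂ δ₁ δ₂ δ₃ t).ncard = 1) :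
    (t ^ b * (2 * δ₁ t * ε₀ t * ε₁ t) + ε₂ t * (δ₂ t * ε₂ t - δ₃ t * ε₁ t)) ^ 2 =
      t ^ b * (4 * (δ₁ t * ε₀ t * ε₁ t ^ 2) * (t ^ b * (δ₁ t * ε₀ t) - δ₃ t * ε₂ t)) := by
  have hε₀' : (ε₀ t : ℂ) ≠ 0 := by exact_mod_cast hε₀
  have hε₂' : (ε₂ t : ℂ) ≠ 0 := by exact_mod_cast hε₂
  have hδ₂' : (δ₂ t : ℂ) ≠ 0 := by exact_mod_cast hδ₂
  have hne' : ((t ^ b : ℝ) : ℂ) * (δ₁ t * ε₀ t) - δ₃ t * ε₂ t ≠ 0 := by exact_mod_cast hne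
  have key := sq_eq_four_mul_of_ncard_eq_one h (fun z => -(ε₀ t + ε₁ t * z) / ε₂ t)
    (A := t ^ b * δ₁ t * (ε₁ t * ε₁ t))
    (B := t ^ b * (2 * δ₁ t * ε₀ t * ε₁ t) + ε₂ t * (δ₂ t * ε₂ t - δ₃ t * ε₁ t))
    (C := ε₀ t * (t ^ b * (δ₁ t * ε₀ t) - δ₃ t * ε₂ t))
    (by positivity) fun z hz => by
      simp only [Complex.ofReal_mul, Complex.ofReal_sub, Complex.ofReal_add,
        Complex.ofReal_ofNat] at hz
      obtain ⟨w, hw⟩ : ∃ w : ℂ, w = -(ε₀ t + ε₁ t * z) / ε₂ t := ⟨_, rfl⟩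
      have hlin : (ε₀ t : ℂ) + ε₁ t * z + ε₂ t * w = 0 := by rw [hw]; field_simp; ring
      have hred : (δ₁ t : ℂ) * ((t ^ b : ℝ) : ℂ) * z ^ 0 * w ^ 2 + δ₂ t * z + δ₃ t * w = 0 := by
        apply mul_left_cancel₀ (pow_ne_zero 2 hε₂')
        linear_combination hz + ((δ₃ t : ℂ) * ε₂ t +
          δ₁ t * ((t ^ b : ℝ) : ℂ) * (ε₂ t * w - (ε₀ t + ε₁ t * z))) * hlin
      have hz0 : z ≠ 0 := by
        rintro rfl
        exact mul_ne_zero hε₀' hne' (by linear_combination hz)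
      rw [← hw]
      refine mem_Sloc2_of_reduced hz0 ?_ hlin hred
      rintro rfl
      exact mul_ne_zero hδ₂' hz0 (by linear_combination hred)
  linear_combination key

end Discriminant

/-- Necessary condition for a multiplicity-2 real tangency along the segment
`E`: if the two intersection points collide for a sequence of parameters
tending to `0`, then the real phase structures agree and `E` is relatively
twisted. -/
theorem segment_tangency_necessary_condition
    (b : ℝ) (hb : 0 < b) (m n p q : ℕ)
    (h1 : m + n = p + q + 2) (hmp : p ≤ m) (hnq : q ≤ n)
    (ε₀ ε₁ ε₂ δ₁ δ₂ δ₃ : ℝ → ℝ) (ε₀0 ε₁0 ε₂0 δ₁0 δ₂0 δ₃0 : ℝ)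
    (hε₀ : Tendsto ε₀ (𝓝[>] 0) (𝓝 ε₀0)) (hε₀0 : ε₀0 ≠ 0)
    (hε₁ : Tendsto ε₁ (𝓝[>] 0) (𝓝 ε₁0)) (hε₁0 : ε₁0 ≠ 0)
    (hε₂ : Tendsto ε₂ (𝓝[>] 0) (𝓝 ε₂0)) (hε₂0 : ε₂0 ≠ 0)
    (hδ₁ : Tendsto δ₁ (𝓝[>] 0) (𝓝 δ₁0)) (hδ₁0 : δ₁0 ≠ 0)
    (hδ₂ : Tendsto δ₂ (𝓝[>] 0) (𝓝 δ₂0)) (hδ₂0 : δ₂0 ≠ 0)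
    (hδ₃ : Tendsto δ₃ (𝓝[>] 0) (𝓝 δ₃0)) (hδ₃0 : δ₃0 ≠ 0)
    (tk : ℕ → ℝ) (htkpos : ∀ k, 0 < tk k)
    (htk : Tendsto tk atTop (𝓝 0))
    (hone : ∀ k, (Sloc2 b m n p q ε₀ ε₁ ε₂ δ₁ δ₂ δ₃ (tk k)).ncard = 1) :
    δ₂0 * ε₂0 = δ₃0 * ε₁0 ∧
    δ₁0 * δ₃0 * ε₀0 * ε₂0 * (-(ε₁0 * ε₂0)) ^ (n - q) < 0 ∧
    0 < δ₂0 * δ₃0 * ε₁0 * ε₂0 := by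
  have htk' : Tendsto tk atTop (𝓝[>] 0) :=
    tendsto_nhdsWithin_iff.mpr ⟨htk, Eventually.of_forall htkpos⟩
  have hspos : ∀ k, 0 < tk k ^ b := fun k => Real.rpow_pos_of_pos (htkpos k) b
  have hs : Tendsto (fun k => tk k ^ b) atTop (𝓝 0) := by
    simpa [Real.zero_rpow hb.ne'] using htk.rpow_const (Or.inr hb.le)
  replace hε₀ : Tendsto (fun k => ε₀ (tk k)) atTop (𝓝 ε₀0) := hε₀.comp htk'
  replace hε₁ : Tendsto (fun k => ε₁ (tk k)) atTop (𝓝 ε₁0) := hε₁.comp htk'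
  replace hε₂ : Tendsto (fun k => ε₂ (tk k)) atTop (𝓝 ε₂0) := hε₂.comp htk'
  replace hδ₁ : Tendsto (fun k => δ₁ (tk k)) atTop (𝓝 δ₁0) := hδ₁.comp htk'
  replace hδ₂ : Tendsto (fun k => δ₂ (tk k)) atTop (𝓝 δ₂0) := hδ₂.comp htk'
  replace hδ₃ : Tendsto (fun k => δ₃ (tk k)) atTop (𝓝 δ₃0) := hδ₃.comp htk'
  have hD := (hδ₂.mul hε₂).sub (hδ₃.mul hε₁)
  suffices H : δ₂0 * ε₂0 = δ₃0 * ε₁0 ∧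
      δ₁0 * δ₃0 * ε₀0 * ε₂0 * (-(ε₁0 * ε₂0)) ^ (n - q) < 0 by
    refine ⟨H.1, H.2, ?_⟩
    have hpos : 0 < (δ₂0 * ε₂0) ^ 2 := by positivity
    linear_combination hpos + δ₂0 * ε₂0 * H.1
  obtain ⟨i, rfl⟩ := Nat.exists_eq_add_of_le hmp
  obtain ⟨j, rfl⟩ := Nat.exists_eq_add_of_le hnq
  rw [Nat.add_sub_cancel_left]
  obtain ⟨rfl, rfl⟩ | ⟨rfl, rfl⟩ | ⟨rfl, rfl⟩ :
      (i = 2 ∧ j = 0) ∨ (i = 1 ∧ j = 1) ∨ (i = 0 ∧ j = 2) := by omega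
  · have hne := ((hδ₂.mul hε₁).sub ((hδ₁.mul hs).mul hε₀)).eventually_ne
      (show δ₂0 * ε₁0 - δ₁0 * 0 * ε₀0 ≠ 0 by simp [*])
    obtain ⟨hB, hY⟩ := limit_eq_zero_and_pos_of_sq_eq_mul hs hspos hD
      ((((hδ₁.mul hδ₃).mul hε₀).mul hε₂).const_mul (-4)) (by simp [*]) (by
        filter_upwards [hε₀.eventually_ne hε₀0, hε₂.eventually_ne hε₂0, hδ₁.eventually_ne hδ₁0,
          hδ₃.eventually_ne hδ₃0, hne] with k h₀ h₂ h₁' h₃' hk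
        exact sq_eq_of_ncard_Sloc2_two_zero (hspos k).ne' h₀ h₂ h₁' h₃' hk (hone k))
    exact ⟨sub_eq_zero.mp hB, by linarith⟩
  · obtain ⟨hB, hY⟩ := limit_eq_zero_and_pos_of_sq_eq_mul hs hspos
      (hD.sub (hs.mul (hδ₁.mul hε₀)))
      ((((hδ₁.mul hδ₃).mul hε₀).mul hε₁).const_mul 4) (by simp [*]) (by
        filter_upwards [hε₀.eventually_ne hε₀0, hε₁.eventually_ne hε₁0, hε₂.eventually_ne hε₂0,
          hδ₁.eventually_ne hδ₁0, hδ₂.eventually_ne hδ₂0, hδ₃.eventually_ne hδ₃0]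
          with k h₀ h₁ h₂ h₁' h₂' h₃'
        exact sq_eq_of_ncard_Sloc2_one_one (hspos k).ne' h₀ h₁ h₂ h₁' h₂' h₃' (hone k))
    refine ⟨by linear_combination hB, ?_⟩
    have hpos : 0 < 4 * (δ₁0 * δ₃0 * ε₀0 * ε₁0) * ε₂0 ^ 2 := by positivity
    linear_combination hpos / 4
  · have hC := (hs.mul (hδ₁.mul hε₀)).sub (hδ₃.mul hε₂)
    have hC0 : 0 * (δ₁0 * ε₀0) - δ₃0 * ε₂0 ≠ 0 := by simp [*]
    obtain ⟨hB, hY⟩ := limit_eq_zero_and_pos_of_sq_eq_mul hs hspos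
      ((hs.mul (((hδ₁.const_mul 2).mul hε₀).mul hε₁)).add (hε₂.mul hD))
      ((((hδ₁.mul hε₀).mul (hε₁.pow 2)).const_mul 4).mul hC) (by simp [*]) (by
        filter_upwards [hε₀.eventually_ne hε₀0, hε₁.eventually_ne hε₁0, hε₂.eventually_ne hε₂0,
          hδ₁.eventually_ne hδ₁0, hδ₂.eventually_ne hδ₂0, hC.eventually_ne hC0]
          with k h₀ h₁ h₂ h₁' h₂' hk
        exact sq_eq_of_ncard_Sloc2_zero_two (hspos k).ne' h₀ h₁ h₂ h₁' h₂' hk (hone k))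
    constructor
    · apply mul_left_cancel₀ hε₂0
      linear_combination hB
    · have hpos := mul_pos hY (by positivity : 0 < ε₂0 ^ 2)
      linear_combination hpos / 4
end
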